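/- Let A° be an R-flat R-algebra topologically of finite type and A = A° ⊗_R K the corresponding affinoid algebra. Then the reduction map ξ : Sp A → Max A° is surjective. -/

import Mathlib

/-!  Prelude: rigid-analytic basics over a complete non-archimedean
algebraically closed field `K`. -/

open scoped BoundedContinuousFunction

noncomputable section

namespace RigidQE

variable (K : Type) [NormedField K] [CompleteSpace K] [IsAlgClosed K] [IsUltrametricDist K]

/-- The valuation ring `R = {x : K | ‖x‖ ≤ 1}` of `K`. -/
def Ro : Subring K where
  carrier := {x | ‖x‖ ≤ 1}
  zero_mem' := by simp
  one_mem' := by simp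
  add_mem' := fun {a b} ha hb => le_trans (IsUltrametricDist.norm_add_le_max a b) (max_le ha hb)
  neg_mem' := fun {a} ha => by simpa using ha
  mul_mem' := fun {a b} ha hb => le_trans (norm_mul_le a b)
    (by simpa using mul_le_one₀ ha (norm_nonneg b) hb)

/-- The maximal ideal `℘ = {x : K | ‖x‖ < 1}` of the valuation ring. -/
def RoMax : Ideal (Ro K) where
  carrier := {x | ‖(x : K)‖ < 1}
  zero_mem' := by simp
  add_mem' := fun {a b} ha hb =>
    lt_of_le_of_lt (IsUltrametricDist.norm_add_le_max (a : K) (b : K)) (max_lt ha hb)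
  smul_mem' := fun c x hx => by
    have h1 : ‖(c : K)‖ ≤ 1 := c.2
    have : ‖(c : K) * (x : K)‖ ≤ 1 * ‖(x : K)‖ := le_trans (norm_mul_le _ _) (by gcongr)
    simpa using lt_of_le_of_lt (by simpa using this) hx

/-- The closed unit polydisc `R^m ⊆ K^m`. -/
def UnitBall (m : ℕ) : Set (Fin m → K) := {x | ∀ i, ‖x i‖ ≤ 1}

/-- The `i`-th coordinate function on the unit polydisc, as a bounded continuous function. -/
def coordFn (m : ℕ) (i : Fin m) : (UnitBall K m) →ᵇ K :=
  BoundedContinuousFunction.ofNormedAddCommGroup (fun x => x.1 i)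
    ((continuous_apply i).comp continuous_subtype_val) 1 (fun x => x.2 i)

/-- The Tate algebra `K⟨S₁,…,Sₘ⟩` of strictly convergent power series, realised concretely
as the closure, with respect to the supremum norm, of the algebra of polynomial functions
on the unit polydisc. -/
def TateAlg (m : ℕ) : Subalgebra K ((UnitBall K m) →ᵇ K) :=
  (Algebra.adjoin K (Set.range (coordFn K m))).topologicalClosure

end RigidQE

end

noncomputable section
namespace RigidQE

variable (K : Type) [NormedField K] [CompleteSpace K] [IsAlgClosed K] [IsUltrametricDist K]

/-- The projection `R^{m+N} → R^m` on the first `m` coordinates. -/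
def ballProj (m N : ℕ) (z : UnitBall K (m + N)) : UnitBall K m :=
  ⟨fun i => z.1 (Fin.castAdd N i), fun i => z.2 _⟩

lemma ballProj_continuous (m N : ℕ) : Continuous (ballProj K m N) := by
  apply Continuous.subtype_mk
  exact continuous_pi fun i => (continuous_apply _).comp continuous_subtype_val

/-- Pullback of bounded functions along the projection of polydiscs. -/
def ballPull (m N : ℕ) : ((UnitBall K m) →ᵇ K) →ₐ[K] ((UnitBall K (m + N)) →ᵇ K) where
  toFun f := f.compContinuous ⟨ballProj K m N, ballProj_continuous K m N⟩
  map_one' := by ext z; simp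
  map_mul' f g := by ext z; simp
  map_zero' := by ext z; simp
  map_add' f g := by ext z; simp
  commutes' c := by ext z; simp

lemma ballPull_lipschitz (m N : ℕ) : LipschitzWith 1 (ballPull K m N) := by
  apply LipschitzWith.of_dist_le_mul
  intro f g
  simp only [NNReal.coe_one, one_mul]
  refine (BoundedContinuousFunction.dist_le (dist_nonneg (x := f) (y := g))).2 ?_
  intro z
  exact BoundedContinuousFunction.dist_coe_le_dist (f := f) (g := g) (ballProj K m N z)

lemma ballPull_mem_TateAlg (m N : ℕ) {f : (UnitBall K m) →ᵇ K} (hf : f ∈ TateAlg K m) :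
    ballPull K m N f ∈ TateAlg K (m + N) := by
  have hsub : (ballPull K m N) '' (Algebra.adjoin K (Set.range (coordFn K m)) : Set _)
      ⊆ (Algebra.adjoin K (Set.range (coordFn K (m + N))) : Set _) := by
    rintro g ⟨g', hg', rfl⟩
    have : ballPull K m N g' ∈ (Algebra.adjoin K (Set.range (coordFn K m))).map
        (ballPull K m N) := Subalgebra.mem_map.2 ⟨g', hg', rfl⟩
    rw [AlgHom.map_adjoin] at this
    refine Algebra.adjoin_mono ?_ this
    rintro h ⟨h', ⟨i, rfl⟩, rfl⟩
    exact ⟨Fin.castAdd N i, by ext z; rfl⟩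
  have := (image_closure_subset_closure_image (s := (Algebra.adjoin K (Set.range (coordFn K m)) :
      Set _)) (ballPull_lipschitz K m N).continuous) (Set.mem_image_of_mem _ hf)
  exact closure_mono hsub this

/-- An affinoid variety, realised concretely as the zero locus, inside a closed unit
polydisc, of a set of strictly convergent power series. -/
structure Affinoid where
  m : ℕ
  carrier : Set (UnitBall K m)
  isZeroLocus : ∃ S : Set ((UnitBall K m) →ᵇ K),
    (∀ f ∈ S, f ∈ TateAlg K m) ∧ carrier = {x | ∀ f ∈ S, f x = 0}

variable {K}

/-- Restriction of (bounded continuous) functions on the polydisc to a subset, as plain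
functions. -/
def resHom {m : ℕ} (Z : Set (UnitBall K m)) : ((UnitBall K m) →ᵇ K) →ₐ[K] (Z → K) where
  toFun f := fun z => f z.1
  map_one' := rfl
  map_mul' f g := rfl
  map_zero' := rfl
  map_add' f g := rfl
  commutes' c := rfl

/-- The affinoid algebra of `X`, realised concretely as the algebra of functions on `X`
which are restrictions of strictly convergent power series.  (Since `K` is algebraically
closed, this faithfully represents the reduced affinoid algebra.) -/
def Affinoid.O (X : Affinoid K) : Subalgebra K (X.carrier → K) :=
  (TateAlg K X.m).map (resHom X.carrier)

/-- A basic semianalytic subset of an affinoid variety. -/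
def IsBasicSemianalytic (X : Affinoid K) (S : Set X.carrier) : Prop :=
  ∃ (mm n : ℕ) (p q : Fin mm → X.O), n ≤ mm ∧
    S = {x | (∀ i : Fin mm, (i : ℕ) < n → ‖(p i : X.carrier → K) x‖ ≤ ‖(q i : X.carrier → K) x‖)
      ∧ (∀ i : Fin mm, n ≤ (i : ℕ) → ‖(p i : X.carrier → K) x‖ < ‖(q i : X.carrier → K) x‖)}

/-- A semianalytic subset of an affinoid variety: a finite union of basic sets. -/
def IsSemianalytic (X : Affinoid K) (S : Set X.carrier) : Prop :=
  ∃ (k : ℕ) (B : Fin k → Set X.carrier),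
    (∀ j, IsBasicSemianalytic X (B j)) ∧ S = ⋃ j, B j

variable (K)

/-- The product `X × R^N` of an affinoid variety with a closed unit polydisc. -/
def Affinoid.prod (X : Affinoid K) (N : ℕ) : Affinoid K where
  m := X.m + N
  carrier := {z | ballProj K X.m N z ∈ X.carrier}
  isZeroLocus := by
    obtain ⟨S, hS, hXS⟩ := X.isZeroLocus
    refine ⟨(ballPull K X.m N) '' S, ?_, ?_⟩
    · rintro f ⟨f', hf', rfl⟩
      exact ballPull_mem_TateAlg K X.m N (hS f' hf')
    · ext z
      simp only [Set.mem_setOf_eq, hXS, Set.forall_mem_image]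
      rfl

variable {K}

/-- The projection map `X × R^N → X` on points. -/
def Affinoid.projFun (X : Affinoid K) (N : ℕ) (z : (X.prod K N).carrier) : X.carrier :=
  ⟨ballProj K X.m N z.1, z.2⟩

/-- A subanalytic subset of an affinoid variety: the image of a semianalytic subset of
`X × R^N` under the projection `X × R^N → X`. -/
def IsSubanalytic (X : Affinoid K) (S : Set X.carrier) : Prop :=
  ∃ (N : ℕ) (T : Set (X.prod K N).carrier),
    IsSemianalytic (X.prod K N) T ∧ S = (X.projFun N) '' T

end RigidQE
end

set_option synthInstance.maxHeartbeats 1000000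
set_option maxHeartbeats 1000000

noncomputable section
namespace RigidQE

open scoped TensorProduct

variable (K : Type) [NormedField K] [CompleteSpace K] [IsAlgClosed K] [IsUltrametricDist K]

/-- The ring `R⟨S₁,…,Sₘ⟩` of strictly convergent power series over the valuation ring
`R`: the strictly convergent power series of (Gauss = supremum) norm at most one, as an
`R`-subalgebra of the bounded continuous functions on the polydisc. -/
def TateAlgR (m : ℕ) : Subalgebra (Ro K) ((UnitBall K m) →ᵇ K) where
  carrier := {f | f ∈ TateAlg K m ∧ ‖f‖ ≤ 1}
  add_mem' := fun {f g} hf hg => ⟨add_mem hf.1 hg.1, by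
    refine (BoundedContinuousFunction.norm_le zero_le_one).2 fun x => ?_
    have := IsUltrametricDist.norm_add_le_max (f x) (g x)
    refine le_trans (by simpa using this) (max_le ?_ ?_)
    · exact le_trans (f.norm_coe_le_norm x) hf.2
    · exact le_trans (g.norm_coe_le_norm x) hg.2⟩
  mul_mem' := fun {f g} hf hg => ⟨mul_mem hf.1 hg.1,
    le_trans (norm_mul_le f g) (by simpa using mul_le_one₀ hf.2 (norm_nonneg g) hg.2)⟩
  algebraMap_mem' := fun r => by
    constructor
    · show algebraMap K _ (r : K) ∈ TateAlg K m
      exact Subalgebra.algebraMap_mem _ _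
    · show ‖algebraMap K ((UnitBall K m) →ᵇ K) (r : K)‖ ≤ 1
      refine (BoundedContinuousFunction.norm_le zero_le_one).2 fun x => ?_
      calc ‖(algebraMap K ((UnitBall K m) →ᵇ K) (r : K)) x‖ = ‖(r : K)‖ := by simp
      _ ≤ 1 := r.2

/-- An `R`-algebra is topologically of finite type if it is a homomorphic image of some
ring `R⟨S₁,…,Sₘ⟩` of strictly convergent power series over `R`. -/
def IsTopFinType (A : Type) [CommRing A] [Algebra (Ro K) A] : Prop :=
  ∃ (m : ℕ) (φ : TateAlgR K m →ₐ[Ro K] A), Function.Surjective φ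

end RigidQE
end

set_option synthInstance.maxHeartbeats 1000000
set_option maxHeartbeats 1000000

noncomputable section
namespace RigidQE

open scoped TensorProduct

variable (K : Type) [NormedField K] [CompleteSpace K] [IsAlgClosed K] [IsUltrametricDist K]
variable (A0 : Type) [CommRing A0] [Algebra (Ro K) A0]

/-- The points of `Sp A`, for `A = A° ⊗_R K` the affinoid algebra generated by an
`R`-algebra `A°` topologically of finite type: since `K` is algebraically closed, these
are the `K`-algebra morphisms `A → K`. -/
abbrev SpPts : Type := (K ⊗[Ro K] A0) →ₐ[K] K

/-- The ideal `℘A°` of `A°`. -/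
def wpIdeal : Ideal A0 := Ideal.map (algebraMap (Ro K) A0) (RoMax K)

/-- The reduction `ξ(y) = (m_y ∩ A°) + ℘A°` of a point `y ∈ Sp A`. -/
def redIdeal (y : SpPts K A0) : Ideal A0 :=
  (RingHom.ker y.toRingHom).comap
      (Algebra.TensorProduct.includeRight (R := Ro K) (A := K) (B := A0)).toRingHom
    ⊔ wpIdeal K A0

/-- The special subset of `Sp A` determined by `h₁, …, h_s ∈ A°` and `r ≤ s`:
`{y : ‖hᵢ(y)‖ < 1 for i < r, ‖hᵢ(y)‖ ≥ 1 for r ≤ i < s}`. -/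
def specialSet (s r : ℕ) (h : Fin s → A0) : Set (SpPts K A0) :=
  {y | (∀ i : Fin s, (i : ℕ) < r →
          ‖y (Algebra.TensorProduct.includeRight (h i))‖ < 1) ∧
       (∀ i : Fin s, r ≤ (i : ℕ) →
          1 ≤ ‖y (Algebra.TensorProduct.includeRight (h i))‖)}

/-- The locally closed subset of `Max A°` determined by `h₁, …, h_s ∈ A°` and `r ≤ s`:
the maximal ideals containing `hᵢ` for `i < r` and omitting `hᵢ` for `r ≤ i < s`. -/
def specialLocus (s r : ℕ) (h : Fin s → A0) : Set (Ideal A0) :=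
  {I | I.IsMaximal ∧ (∀ i : Fin s, (i : ℕ) < r → h i ∈ I) ∧
       (∀ i : Fin s, r ≤ (i : ℕ) → h i ∉ I)}

/-- Finite Boolean combinations of a family of generating sets. -/
inductive BoolComb {α : Type} (G : Set (Set α)) : Set α → Prop
  | base {s : Set α} : s ∈ G → BoolComb G s
  | compl {s : Set α} : BoolComb G s → BoolComb G sᶜ
  | union {s t : Set α} : BoolComb G s → BoolComb G t → BoolComb G (s ∪ t)

/-- The maximal spectrum of `A°/℘A°`, realised as the maximal ideals of `A°`
containing `℘A°`. -/
abbrev MaxModWp : Type := {I : Ideal A0 // I.IsMaximal ∧ wpIdeal K A0 ≤ I}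

/-- The class of finite Boolean combinations of special subsets of `Sp A`. -/
def specialClass : Set (Set (SpPts K A0)) :=
  {S | BoolComb {T | ∃ (s r : ℕ) (h : Fin s → A0), r ≤ s ∧ T = specialSet K A0 s r h} S}

/-- The class of constructible subsets of `Spec A°/℘A°` (for the Jacobson, Noetherian
ring `A°/℘A°`: the finite Boolean combinations of closed loci of maximal ideals). -/
def constructibleClass : Set (Set (MaxModWp K A0)) :=
  {C | BoolComb {D | ∃ a : A0, D = {I : MaxModWp K A0 | a ∈ I.1}} C}

/-- The map on subsets induced by the reduction map `ξ`. -/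
def redImage (S : Set (SpPts K A0)) : Set (MaxModWp K A0) :=
  {I | ∃ y ∈ S, redIdeal K A0 y = I.1}

end RigidQE
end

noncomputable section
namespace RigidQE

section ValuationRing

variable {K : Type} [NormedField K] [IsUltrametricDist K]

/-- An element of `K` integral over the valuation ring has norm at most one. -/
lemma norm_le_one_of_monic_of_eval₂_eq_zero {p : Polynomial (Ro K)} (hp : p.Monic) {x : K}
    (hx : p.eval₂ (Ro K).subtype x = 0) : ‖x‖ ≤ 1 := by
  have hv : (NormedField.valuation (K := K)).Integers (Ro K) :=
    { hom_inj := Subtype.val_injective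
      map_le_one := fun r => r.2
      exists_of_le_one := fun r hr => ⟨⟨r, hr⟩, rfl⟩ }
  exact hv.mem_of_integral ⟨p, hp, hx⟩

/-- The valuation ring of an algebraically closed field contains a root of each monic polynomial
of positive degree. -/
lemma exists_root_of_monic [IsAlgClosed K] {p : Polynomial (Ro K)} (hp : p.Monic)
    (hdeg : p.natDegree ≠ 0) : ∃ a : Ro K, p.IsRoot a := by
  have hd : (p.map (Ro K).subtype).degree ≠ 0 := by
    rw [hp.degree_map, Polynomial.degree_eq_natDegree hp.ne_zero]
    exact_mod_cast hdeg
  obtain ⟨x, hx⟩ := IsAlgClosed.exists_root _ hd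
  rw [Polynomial.IsRoot, Polynomial.eval_map] at hx
  refine ⟨⟨x, norm_le_one_of_monic_of_eval₂_eq_zero hp hx⟩, Subtype.val_injective ?_⟩
  have := Polynomial.eval₂_at_apply (p := p) (Ro K).subtype
    ⟨x, norm_le_one_of_monic_of_eval₂_eq_zero hp hx⟩
  exact this.symm.trans hx

/-- A monic polynomial over the valuation ring of an algebraically closed field is a product of
linear factors. -/
lemma splits_of_monic [IsAlgClosed K] (n : ℕ) :
    ∀ p : Polynomial (Ro K), p.Monic → p.natDegree = n →
      ∃ s : Multiset (Ro K), p = (s.map fun a => Polynomial.X - Polynomial.C a).prod := by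
  induction n with
  | zero =>
    intro p hp hn
    exact ⟨0, by simpa using hp.natDegree_eq_zero.1 hn⟩
  | succ n ih =>
    intro p hp hn
    obtain ⟨a, ha⟩ := exists_root_of_monic hp (by omega)
    obtain ⟨q, rfl⟩ := Polynomial.dvd_iff_isRoot.2 ha
    have hq : q.Monic := (Polynomial.monic_X_sub_C a).of_mul_monic_left hp
    rw [(Polynomial.monic_X_sub_C a).natDegree_mul hq, Polynomial.natDegree_X_sub_C] at hn
    obtain ⟨s, rfl⟩ := ih q hq (by omega)
    exact ⟨a ::ₘ s, by simp⟩

lemma isUnit_of_norm_eq_one {r : Ro K} (hr : ‖(r : K)‖ = 1) : IsUnit r := by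
  have h0 : (r : K) ≠ 0 := by
    intro h
    simp [h] at hr
  refine IsUnit.of_mul_eq_one ⟨(r : K)⁻¹, ?_⟩ (Subtype.val_injective (mul_inv_cancel₀ h0))
  change ‖(r : K)⁻¹‖ ≤ 1
  simp [hr]

lemma mem_RoMax {r : Ro K} : r ∈ RoMax K ↔ ‖(r : K)‖ < 1 := Iff.rfl

lemma notMem_RoMax {r : Ro K} : r ∉ RoMax K ↔ ‖(r : K)‖ = 1 := by
  rw [mem_RoMax, not_lt]
  exact ⟨fun h => le_antisymm r.2 h, fun h => h.ge⟩

instance RoMax.isMaximal : (RoMax K).IsMaximal := by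
  rw [Ideal.isMaximal_iff]
  refine ⟨by simp [mem_RoMax], fun J r _ hr hrJ => ?_⟩
  exact (Ideal.eq_top_iff_one J).1 (J.eq_top_of_isUnit_mem hrJ
    (isUnit_of_norm_eq_one (notMem_RoMax.1 hr)))

variable (K) in
/-- The residue field of `K`. -/
abbrev Res : Type := Ro K ⧸ RoMax K

instance Res.field : Field (Res K) := Ideal.Quotient.field _

instance Res.isAlgClosed [IsAlgClosed K] : IsAlgClosed (Res K) := by
  refine IsAlgClosed.of_exists_root _ fun p hp hirr => ?_
  obtain ⟨q, rfl, hdeg, hq⟩ := Polynomial.lifts_and_natDegree_eq_and_monic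
    (f := Ideal.Quotient.mk (RoMax K)) (p := p)
    ((Polynomial.mem_lifts _).2 (Polynomial.map_surjective _ Ideal.Quotient.mk_surjective p)) hp
  obtain ⟨a, ha⟩ := exists_root_of_monic hq (by rw [hdeg]; exact hirr.natDegree_pos.ne')
  exact ⟨Ideal.Quotient.mk _ a, (ha.map (f := Ideal.Quotient.mk (RoMax K)))⟩

end ValuationRing

section TateRing

variable {K : Type} [NormedField K] [IsUltrametricDist K] [CompleteSpace K] [IsAlgClosed K]
variable {m n : ℕ}

instance UnitBall.instNonempty : Nonempty (UnitBall K m) := ⟨⟨0, fun i => by simp⟩⟩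

/-- The point of the unit polydisc with the given coordinates in the valuation ring. -/
def ofCoords (a : Fin m → Ro K) : UnitBall K m := ⟨fun i => a i, fun i => (a i).2⟩

/-- The coordinates of a point of the unit polydisc. -/
def coords (z : UnitBall K m) : Fin m → Ro K := fun i => ⟨z.1 i, z.2 i⟩

@[simp] lemma coords_ofCoords (a : Fin m → Ro K) : coords (ofCoords a) = a := rfl

@[simp] lemma ofCoords_coords (z : UnitBall K m) : ofCoords (coords z) = z := rfl

/-- Evaluation of a strictly convergent power series at a point of the unit polydisc. -/
def evalPt (z : UnitBall K m) : TateAlgR K m →ₐ[Ro K] Ro K where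
  toFun f := ⟨f.1 z, (f.1.norm_coe_le_norm z).trans f.2.2⟩
  map_one' := rfl
  map_mul' _ _ := rfl
  map_zero' := rfl
  map_add' _ _ := rfl
  commutes' r := Subtype.ext <| by
    change algebraMap K (UnitBall K m →ᵇ K) (r : K) z = r
    simp

lemma coe_evalPt (z : UnitBall K m) (f : TateAlgR K m) : (evalPt z f : K) = f.1 z := rfl

lemma TateAlgR.ext_evalPt {f g : TateAlgR K m} (h : ∀ z, evalPt z f = evalPt z g) : f = g :=
  Subtype.ext (BoundedContinuousFunction.ext fun z => congrArg Subtype.val (h z))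

lemma TateAlgR.norm_le_iff {f : TateAlgR K m} {r : ℝ} (hr : 0 ≤ r) :
    ‖f‖ ≤ r ↔ ∀ z, ‖(evalPt z f : K)‖ ≤ r :=
  BoundedContinuousFunction.norm_le (f := f.1) hr

lemma TateAlgR.norm_evalPt_le (f : TateAlgR K m) (z : UnitBall K m) :
    ‖(evalPt z f : K)‖ ≤ ‖f‖ := f.1.norm_coe_le_norm z

lemma TateAlgR.norm_le_one (f : TateAlgR K m) : ‖f‖ ≤ 1 := f.2.2

instance TateAlgR.isUltrametricDist : IsUltrametricDist (TateAlgR K m) := by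
  refine IsUltrametricDist.isUltrametricDist_of_forall_norm_add_le_max_norm fun f g => ?_
  refine (norm_le_iff (le_max_of_le_left (norm_nonneg f))).2 fun z => ?_
  rw [map_add]
  exact (IsUltrametricDist.norm_add_le_max (evalPt z f : K) (evalPt z g : K)).trans
    (max_le_max (norm_evalPt_le f z) (norm_evalPt_le g z))

instance TateAlgR.completeSpace : CompleteSpace (TateAlgR K m) := by
  have h : IsClosed {f : UnitBall K m →ᵇ K | f ∈ TateAlg K m ∧ ‖f‖ ≤ 1} :=
    (Subalgebra.isClosed_topologicalClosure _).inter (isClosed_le continuous_norm continuous_const)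
  exact h.completeSpace_coe

lemma TateAlgR.norm_algebraMap_mul (c : Ro K) (f : TateAlgR K m) :
    ‖algebraMap (Ro K) (TateAlgR K m) c * f‖ = ‖(c : K)‖ * ‖f‖ := by
  have : (algebraMap (Ro K) (TateAlgR K m) c * f).1 = (c : K) • f.1 := by
    ext z
    have := coe_evalPt z (algebraMap (Ro K) (TateAlgR K m) c * f)
    rw [map_mul, AlgHom.commutes] at this
    exact this.symm
  change ‖(algebraMap (Ro K) (TateAlgR K m) c * f).1‖ = _
  rw [this, norm_smul]
  rfl

/-- The function on the unit polydisc defined by a polynomial over the valuation ring. -/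
def polyFn : MvPolynomial (Fin m) (Ro K) →ₐ[Ro K] TateAlgR K m :=
  MvPolynomial.aeval fun i => ⟨coordFn K m i,
    Subalgebra.le_topologicalClosure _ (Algebra.subset_adjoin ⟨i, rfl⟩),
    (BoundedContinuousFunction.norm_le zero_le_one).2 fun z => z.2 i⟩

/-- The `i`-th coordinate as an element of the ring of strictly convergent power series. -/
abbrev coordR (i : Fin m) : TateAlgR K m := polyFn (MvPolynomial.X i)

lemma evalPt_polyFn (z : UnitBall K m) (p : MvPolynomial (Fin m) (Ro K)) :
    evalPt z (polyFn p) = MvPolynomial.eval (coords z) p := by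
  have : (evalPt z).comp polyFn = MvPolynomial.aeval (coords z) := by
    ext i
    simp [polyFn]
    rfl
  simpa [MvPolynomial.aeval_eq_eval] using congrArg (fun φ => φ p) this

lemma evalPt_coordR (z : UnitBall K m) (i : Fin m) : evalPt z (coordR i) = coords z i := by
  simp [evalPt_polyFn]

end TateRing
end RigidQE
end

noncomputable section
namespace RigidQE

section GaussNorm

variable {K : Type} [NormedField K] [IsUltrametricDist K]
variable {m : ℕ}

/-- Coefficientwise reduction of polynomials over the valuation ring. -/
abbrev redPoly : MvPolynomial (Fin m) (Ro K) →+* MvPolynomial (Fin m) (Res K) :=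
  MvPolynomial.map (Ideal.Quotient.mk (RoMax K))

/-- A nonzero polynomial over `K` is a scalar multiple of a polynomial over the valuation ring
with nonzero reduction. -/
lemma exists_eq_C_mul_map {q : MvPolynomial (Fin m) K} (hq : q ≠ 0) :
    ∃ d, ∃ p : MvPolynomial (Fin m) (Ro K), q.coeff d ≠ 0 ∧ redPoly p ≠ 0 ∧
      q = MvPolynomial.C (q.coeff d) * MvPolynomial.map (Ro K).subtype p := by
  obtain ⟨d, hd, hmax⟩ := q.support.exists_max_image (fun d => ‖q.coeff d‖)
    (MvPolynomial.support_nonempty.2 hq)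
  have hc : q.coeff d ≠ 0 := MvPolynomial.mem_support_iff.1 hd
  have hle : ∀ e, ‖q.coeff e‖ ≤ ‖q.coeff d‖ := fun e => by
    by_cases he : e ∈ q.support
    · exact hmax e he
    · rw [MvPolynomial.notMem_support_iff.1 he]
      simp
  obtain ⟨p, hp⟩ : ∃ p : MvPolynomial (Fin m) (Ro K),
      MvPolynomial.map (Ro K).subtype p = MvPolynomial.C (q.coeff d)⁻¹ * q := by
    refine MvPolynomial.mem_range_map_iff_coeffs_subset.2 fun x hx => ?_
    obtain ⟨e, _, rfl⟩ := MvPolynomial.mem_coeffs_iff.1 hx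
    refine ⟨⟨(MvPolynomial.C (q.coeff d)⁻¹ * q).coeff e, ?_⟩, rfl⟩
    change ‖(MvPolynomial.C (q.coeff d)⁻¹ * q).coeff e‖ ≤ 1
    rw [MvPolynomial.coeff_C_mul, norm_mul, norm_inv, ← div_eq_inv_mul]
    exact div_le_one_of_le₀ (hle e) (norm_nonneg _)
  refine ⟨d, p, hc, fun h => ?_, ?_⟩
  · have h1 : ((p.coeff d : Ro K) : K) = 1 := by
      have := congrArg (MvPolynomial.coeff d) hp
      rwa [MvPolynomial.coeff_map, MvPolynomial.coeff_C_mul, inv_mul_cancel₀ hc] at this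
    have h2 : p.coeff d ∈ RoMax K := by
      have := congrArg (MvPolynomial.coeff d) h
      rwa [MvPolynomial.coeff_map, MvPolynomial.coeff_zero, Ideal.Quotient.eq_zero_iff_mem] at this
    rw [mem_RoMax, h1] at h2
    simp at h2
  · rw [hp, ← mul_assoc, ← MvPolynomial.C_mul, mul_inv_cancel₀ hc, MvPolynomial.C_1, one_mul]

lemma exists_eq_C_mul {q : MvPolynomial (Fin m) (Ro K)} (hq : q ≠ 0) :
    ∃ d, ∃ p : MvPolynomial (Fin m) (Ro K), q.coeff d ≠ 0 ∧ redPoly p ≠ 0 ∧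
      q = MvPolynomial.C (q.coeff d) * p := by
  have hinj : Function.Injective (MvPolynomial.map (σ := Fin m) (Ro K).subtype) :=
    MvPolynomial.map_injective _ Subtype.val_injective
  obtain ⟨d, p, h1, h2, h3⟩ := exists_eq_C_mul_map ((map_ne_zero_iff _ hinj).2 hq)
  rw [MvPolynomial.coeff_map] at h1 h3
  refine ⟨d, p, fun h => h1 (by rw [h]; rfl), h2, hinj ?_⟩
  rw [map_mul, MvPolynomial.map_C]
  exact h3

variable [CompleteSpace K] [IsAlgClosed K]

lemma norm_polyFn_eq_one {p : MvPolynomial (Fin m) (Ro K)} (hp : redPoly p ≠ 0) :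
    ‖polyFn p‖ = 1 := by
  obtain ⟨a, ha⟩ : ∃ a, MvPolynomial.eval a (redPoly p) ≠ 0 := by
    by_contra! h
    exact hp (MvPolynomial.funext fun a => by simpa using h a)
  choose b hb using fun i => Ideal.Quotient.mk_surjective (a i)
  obtain rfl : (fun i => Ideal.Quotient.mk (RoMax K) (b i)) = a := funext hb
  have h1 : MvPolynomial.eval b p ∉ RoMax K := fun h => ha <| by
    rw [MvPolynomial.eval_map, ← Ideal.Quotient.eq_zero_iff_mem.2 h]
    exact (MvPolynomial.eval₂_comp (Ideal.Quotient.mk (RoMax K)) b p).symm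
  refine le_antisymm (TateAlgR.norm_le_one _) ?_
  have := TateAlgR.norm_evalPt_le (polyFn p) (ofCoords b)
  rwa [evalPt_polyFn, coords_ofCoords, notMem_RoMax.1 h1] at this

lemma norm_polyFn_lt_one {p : MvPolynomial (Fin m) (Ro K)} (hp : redPoly p = 0) :
    ‖polyFn p‖ < 1 := by
  by_cases h0 : p = 0
  · simp [h0]
  obtain ⟨d, q, hd, hq, h⟩ := exists_eq_C_mul h0
  have hmem : p.coeff d ∈ RoMax K := by
    have := congrArg (MvPolynomial.coeff d) hp
    rwa [MvPolynomial.coeff_map, MvPolynomial.coeff_zero, Ideal.Quotient.eq_zero_iff_mem] at this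
  rw [h, map_mul, ← MvPolynomial.algebraMap_eq, AlgHom.commutes, TateAlgR.norm_algebraMap_mul,
    norm_polyFn_eq_one hq, mul_one]
  exact hmem

lemma aeval_coordFn_apply (q : MvPolynomial (Fin m) K) (z : UnitBall K m) :
    MvPolynomial.aeval (coordFn K m) q z = MvPolynomial.eval z.1 q := by
  induction q using MvPolynomial.induction_on with
  | C a => simp
  | add p q hp hq => rw [map_add, map_add, ← hp, ← hq]; rfl
  | mul_X p i hp =>
    rw [map_mul, map_mul, ← hp, MvPolynomial.aeval_X, MvPolynomial.eval_X]
    rfl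

lemma eval_map_subtype (p : MvPolynomial (Fin m) (Ro K)) (z : UnitBall K m) :
    MvPolynomial.eval z.1 (MvPolynomial.map (Ro K).subtype p) = evalPt z (polyFn p) := by
  rw [evalPt_polyFn, MvPolynomial.eval_map]
  exact (MvPolynomial.eval₂_comp (Ro K).subtype (coords z) p).symm

/-- Polynomial functions over the valuation ring are dense in `R⟨S₁,…,Sₘ⟩`. -/
lemma exists_norm_sub_polyFn_lt (f : TateAlgR K m) {ε : ℝ} (hε : 0 < ε) :
    ∃ p : MvPolynomial (Fin m) (Ro K), ‖f - polyFn p‖ < ε := by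
  obtain ⟨b, hb, hfb⟩ := Metric.mem_closure_iff.1 f.2.1 (min ε 1) (lt_min hε one_pos)
  rw [SetLike.mem_coe, Algebra.adjoin_range_eq_range_aeval] at hb
  obtain ⟨q, rfl⟩ := hb
  by_cases hq : q = 0
  · refine ⟨0, ?_⟩
    subst hq
    rw [dist_eq_norm] at hfb
    simp only [map_zero, sub_zero] at hfb ⊢
    exact hfb.trans_le (min_le_left _ _)
  obtain ⟨d, p, -, hp, h⟩ := exists_eq_C_mul_map hq
  have hval (z : UnitBall K m) : (MvPolynomial.aeval (coordFn K m) q : UnitBall K m →ᵇ K) z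
      = q.coeff d * (evalPt z (polyFn p) : K) := by
    rw [aeval_coordFn_apply, ← eval_map_subtype, h, map_mul, MvPolynomial.eval_C, ← h]
  have heq : (MvPolynomial.aeval (coordFn K m) q : UnitBall K m →ᵇ K)
      = q.coeff d • (polyFn p).1 := BoundedContinuousFunction.ext hval
  obtain ⟨c, hc⟩ : ∃ c : Ro K, (c : K) = q.coeff d := by
    refine ⟨⟨q.coeff d, ?_⟩, rfl⟩
    have h1 : ‖(MvPolynomial.aeval (coordFn K m) q : UnitBall K m →ᵇ K)‖ = ‖q.coeff d‖ := by
      rw [heq, norm_smul]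
      change _ * ‖polyFn p‖ = _
      rw [norm_polyFn_eq_one hp, mul_one]
    change ‖q.coeff d‖ ≤ 1
    rw [← h1]
    refine (BoundedContinuousFunction.norm_le zero_le_one).2 fun z => ?_
    have h2 := BoundedContinuousFunction.dist_coe_le_dist (f := f.1)
      (g := MvPolynomial.aeval (coordFn K m) q) z
    rw [dist_comm, dist_eq_norm] at h2
    have h3 := IsUltrametricDist.norm_add_le_max
      ((MvPolynomial.aeval (coordFn K m) q : UnitBall K m →ᵇ K) z - f.1 z) (f.1 z)
    rw [sub_add_cancel] at h3
    exact h3.trans (max_le (h2.trans (hfb.le.trans (min_le_right _ _)))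
      ((f.1.norm_coe_le_norm z).trans f.2.2))
  refine ⟨MvPolynomial.C c * p, ?_⟩
  have h4 : (polyFn (MvPolynomial.C c * p)).1 = MvPolynomial.aeval (coordFn K m) q := by
    ext z
    rw [hval, ← hc, ← coe_evalPt, map_mul, ← MvPolynomial.algebraMap_eq, AlgHom.commutes, map_mul,
      AlgHom.commutes]
    rfl
  change ‖f.1 - (polyFn (MvPolynomial.C c * p)).1‖ < ε
  rw [h4, ← dist_eq_norm]
  exact hfb.trans_le (min_le_left _ _)

/-- Every nonzero element of `R⟨S₁,…,Sₘ⟩` is a scalar multiple of an element of norm one. -/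
lemma exists_eq_algebraMap_mul {f : TateAlgR K m} (hf : f ≠ 0) :
    ∃ (c : Ro K) (g : TateAlgR K m), c ≠ 0 ∧ ‖g‖ = 1 ∧ f = algebraMap (Ro K) _ c * g := by
  obtain ⟨p, hp⟩ := exists_norm_sub_polyFn_lt f (norm_pos_iff.2 hf)
  have hp0 : p ≠ 0 := by
    rintro rfl
    simp at hp
  obtain ⟨d, q, hd, hq, h⟩ := exists_eq_C_mul hp0
  set c : Ro K := p.coeff d with hc
  have hnp : ‖polyFn p‖ = ‖(c : K)‖ := by
    rw [h, map_mul, ← MvPolynomial.algebraMap_eq, AlgHom.commutes, TateAlgR.norm_algebraMap_mul,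
      norm_polyFn_eq_one hq, mul_one]
  have hnorm : ‖f‖ = ‖(c : K)‖ := by
    rw [← hnp, ← norm_neg (polyFn p)]
    refine IsUltrametricDist.norm_eq_of_add_norm_lt_max ?_
    rw [← sub_eq_add_neg]
    exact lt_max_of_lt_left hp
  have hd' : (c : K) ≠ 0 := fun h => hd (Subtype.val_injective h)
  have hg : ‖(c : K)⁻¹ • f.1‖ = 1 := by
    rw [norm_smul, norm_inv]
    change _ * ‖f‖ = 1
    rw [hnorm, inv_mul_cancel₀ (norm_ne_zero_iff.2 hd')]
  refine ⟨c, ⟨(c : K)⁻¹ • f.1, Subalgebra.smul_mem _ f.2.1 _, hg.le⟩, hd, hg, ?_⟩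
  refine TateAlgR.ext_evalPt fun z => Subtype.val_injective ?_
  rw [map_mul, AlgHom.commutes]
  exact (mul_inv_cancel_left₀ hd' _).symm

lemma redPoly_ne_zero_of_norm_sub_lt {f : TateAlgR K m} (hf : ‖f‖ = 1)
    {p : MvPolynomial (Fin m) (Ro K)} (hp : ‖f - polyFn p‖ < 1) : redPoly p ≠ 0 := fun h => by
  have := IsUltrametricDist.norm_add_le_max (f - polyFn p) (polyFn p)
  rw [sub_add_cancel, hf] at this
  exact absurd this (not_le.2 (max_lt hp (norm_polyFn_lt_one h)))

instance TateAlgR.isDomain : IsDomain (TateAlgR K m) := by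
  have hnt : Nontrivial (TateAlgR K m) := (evalPt (ofCoords 0)).toRingHom.domain_nontrivial
  have hnz : NoZeroDivisors (TateAlgR K m) := by
    refine ⟨fun {f g} hfg => ?_⟩
    by_contra! h
    obtain ⟨c, f, hc, hf, rfl⟩ := exists_eq_algebraMap_mul h.1
    obtain ⟨d, g, hd, hg, rfl⟩ := exists_eq_algebraMap_mul h.2
    have h0 : f * g = 0 := by
      rw [mul_mul_mul_comm, ← map_mul, ← norm_eq_zero, norm_algebraMap_mul] at hfg
      refine norm_eq_zero.1 ((mul_eq_zero.1 hfg).resolve_left (norm_ne_zero_iff.2 ?_))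
      exact fun h => mul_ne_zero hc hd (Subtype.val_injective h)
    obtain ⟨p, hp⟩ := exists_norm_sub_polyFn_lt f one_pos
    obtain ⟨q, hq⟩ := exists_norm_sub_polyFn_lt g one_pos
    have h1 := norm_polyFn_eq_one (p := p * q) (by
      rw [map_mul]
      exact mul_ne_zero (redPoly_ne_zero_of_norm_sub_lt hf hp)
        (redPoly_ne_zero_of_norm_sub_lt hg hq))
    have h2 : polyFn (p * q) = -((f - polyFn p) * polyFn q + f * (g - polyFn q)) := by
      rw [map_mul]
      linear_combination h0
    rw [h2, norm_neg] at h1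
    refine absurd h1 (ne_of_lt ((IsUltrametricDist.norm_add_le_max _ _).trans_lt (max_lt ?_ ?_)))
    · exact (norm_mul_le _ _).trans_lt
        (mul_lt_one_of_nonneg_of_lt_one_left (norm_nonneg _) hp (norm_le_one _))
    · exact (norm_mul_le _ _).trans_lt
        (mul_lt_one_of_nonneg_of_lt_one_right (norm_le_one _) (norm_nonneg _) hq)
  exact NoZeroDivisors.to_isDomain _

end GaussNorm
end RigidQE
end

noncomputable section
namespace RigidQE

section Pullback

variable {K : Type} [NormedField K] [IsUltrametricDist K] [CompleteSpace K] [IsAlgClosed K]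
variable {m k : ℕ}

/-- The map of unit polydiscs whose components are the given strictly convergent power series. -/
def ballMap (s : Fin m → TateAlgR K k) : C(UnitBall K k, UnitBall K m) where
  toFun z := ofCoords fun i => evalPt z (s i)
  continuous_toFun := Continuous.subtype_mk (continuous_pi fun i => (s i).1.continuous) _

lemma comp_ballMap_mem_TateAlg (s : Fin m → TateAlgR K k) {f : UnitBall K m →ᵇ K}
    (hf : f ∈ TateAlg K m) : f.compContinuous (ballMap s) ∈ TateAlg K k := by
  let F : (UnitBall K m →ᵇ K) →ₐ[K] (UnitBall K k →ᵇ K) :=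
    { toFun := fun f => f.compContinuous (ballMap s)
      map_one' := rfl
      map_mul' := fun _ _ => rfl
      map_zero' := rfl
      map_add' := fun _ _ => rfl
      commutes' := fun c => by ext z; simp }
  have hF : LipschitzWith 1 F := LipschitzWith.of_dist_le_mul fun f g => by
    rw [NNReal.coe_one, one_mul]
    exact (BoundedContinuousFunction.dist_le (dist_nonneg (x := f) (y := g))).2 fun z =>
      BoundedContinuousFunction.dist_coe_le_dist (f := f) (g := g) (ballMap s z)
  have hsub : (Algebra.adjoin K (Set.range (coordFn K m))).map F ≤ TateAlg K k := by
    rw [AlgHom.map_adjoin, Algebra.adjoin_le_iff]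
    rintro _ ⟨_, ⟨i, rfl⟩, rfl⟩
    exact (s i).2.1
  have hcl := image_closure_subset_closure_image hF.continuous (Set.mem_image_of_mem F hf)
  exact closure_minimal hsub (Subalgebra.isClosed_topologicalClosure _) hcl

/-- Substitution of strictly convergent power series into a strictly convergent power series. -/
def pull (s : Fin m → TateAlgR K k) : TateAlgR K m →ₐ[Ro K] TateAlgR K k where
  toFun f := ⟨f.1.compContinuous (ballMap s), comp_ballMap_mem_TateAlg s f.2.1,
    (BoundedContinuousFunction.norm_le zero_le_one).2 fun z =>
      (f.1.norm_coe_le_norm (ballMap s z)).trans f.2.2⟩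
  map_one' := rfl
  map_mul' _ _ := rfl
  map_zero' := rfl
  map_add' _ _ := rfl
  commutes' r := by
    refine TateAlgR.ext_evalPt fun z => ?_
    rw [AlgHom.commutes]
    exact (evalPt (ballMap s z)).commutes r

lemma evalPt_pull (s : Fin m → TateAlgR K k) (f : TateAlgR K m) (z : UnitBall K k) :
    evalPt z (pull s f) = evalPt (ofCoords fun i => evalPt z (s i)) f := rfl

lemma norm_pull_le (s : Fin m → TateAlgR K k) (f : TateAlgR K m) : ‖pull s f‖ ≤ ‖f‖ :=
  (TateAlgR.norm_le_iff (norm_nonneg f)).2 fun z => TateAlgR.norm_evalPt_le f (ballMap s z)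

lemma pull_polyFn (s : Fin m → TateAlgR K k) (p : MvPolynomial (Fin m) (Ro K)) :
    pull s (polyFn p) = MvPolynomial.aeval s p := by
  have : (pull s).comp polyFn = MvPolynomial.aeval s := by
    ext1 i
    refine TateAlgR.ext_evalPt fun z => ?_
    rw [AlgHom.comp_apply, evalPt_pull, evalPt_coordR, coords_ofCoords, MvPolynomial.aeval_X]
  exact congrArg (fun φ => φ p) this

lemma pull_coordR (s : Fin m → TateAlgR K k) (i : Fin m) : pull s (coordR i) = s i := by
  rw [pull_polyFn, MvPolynomial.aeval_X]

/-- Strictly convergent power series in the last `n` variables, as series in `n + 1` variables. -/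
def succPull {n : ℕ} : TateAlgR K n →ₐ[Ro K] TateAlgR K (n + 1) := pull fun i => coordR i.succ

lemma evalPt_succPull {n : ℕ} (f : TateAlgR K n) (z : UnitBall K (n + 1)) :
    evalPt z (succPull f) = evalPt (ofCoords fun i => coords z i.succ) f := by
  simp only [succPull, evalPt_pull, evalPt_coordR]

lemma norm_succPull_le {n : ℕ} (f : TateAlgR K n) : ‖succPull f‖ ≤ ‖f‖ := norm_pull_le _ f

/-- Restriction of a strictly convergent power series to the line on which all coordinates but
the first are fixed. -/
def restrictLine {n : ℕ} (x : Fin n → Ro K) : TateAlgR K (n + 1) →ₐ[Ro K] TateAlgR K 1 :=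
  pull (Fin.cons (coordR 0) fun i => algebraMap (Ro K) _ (x i))

lemma restrictLine_coordR_zero {n : ℕ} (x : Fin n → Ro K) :
    restrictLine x (coordR 0) = coordR 0 := by
  rw [restrictLine, pull_coordR, Fin.cons_zero]

lemma restrictLine_succPull {n : ℕ} (x : Fin n → Ro K) (f : TateAlgR K n) :
    restrictLine x (succPull f) = algebraMap (Ro K) _ (evalPt (ofCoords x) f) := by
  refine TateAlgR.ext_evalPt fun z => ?_
  rw [restrictLine, evalPt_pull, evalPt_succPull, AlgHom.commutes]
  simp

lemma evalPt_restrictLine {n : ℕ} (x : Fin n → Ro K) (f : TateAlgR K (n + 1)) (a : Ro K) :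
    evalPt (ofCoords fun _ => a) (restrictLine x f) = evalPt (ofCoords (Fin.cons a x)) f := by
  rw [restrictLine, evalPt_pull]
  refine congrArg (fun c => evalPt (ofCoords c) f) (funext fun i => ?_)
  refine Fin.cases ?_ (fun j => ?_) i
  · simp [evalPt_polyFn]
  · simp

lemma eq_of_restrictLine_eq {n : ℕ} {f g : TateAlgR K (n + 1)}
    (h : ∀ x : Fin n → Ro K, restrictLine x f = restrictLine x g) : f = g := by
  refine TateAlgR.ext_evalPt fun z => ?_
  have h1 := congrArg (evalPt (ofCoords fun _ => coords z 0)) (h (Fin.tail (coords z)))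
  rwa [evalPt_restrictLine, evalPt_restrictLine, Fin.cons_self_tail, ofCoords_coords] at h1

/-- The evaluation of strictly convergent power series in no variables. -/
lemma algebraMap_evalPt_of_zero (z : UnitBall K 0) (f : TateAlgR K 0) :
    algebraMap (Ro K) _ (evalPt z f) = f := by
  refine TateAlgR.ext_evalPt fun w => ?_
  rw [AlgHom.commutes, Subsingleton.elim w z]
  rfl

end Pullback
end RigidQE
end

noncomputable section
namespace RigidQE

/-- A norm-nonincreasing additive map from a complete ultrametric group is surjective, with control
of norms, as soon as it is so up to errors of smaller order. -/
lemma exists_eq_of_forall_exists_norm_sub_le {G H : Type*} [NormedAddCommGroup G]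
    [NormedAddCommGroup H] [IsUltrametricDist G] [CompleteSpace G] (L : G →+ H)
    (hL : ∀ x, ‖L x‖ ≤ ‖x‖) {ρ : ℝ} (hρ0 : 0 ≤ ρ) (hρ1 : ρ < 1)
    (h : ∀ y, ∃ x, ‖x‖ ≤ ‖y‖ ∧ ‖y - L x‖ ≤ ρ * ‖y‖) (y : H) :
    ∃ x, L x = y ∧ ‖x‖ ≤ ‖y‖ := by
  choose g hg1 hg2 using h
  let e : ℕ → H := fun n => (fun z => z - L (g z))^[n] y
  have he0 : e 0 = y := rfl
  have he (n : ℕ) : e (n + 1) = e n - L (g (e n)) := Function.iterate_succ_apply' _ n y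
  have hle (n : ℕ) : ‖e n‖ ≤ ρ ^ n * ‖y‖ := by
    induction n with
    | zero => simp [he0]
    | succ n ih =>
      rw [he, pow_succ', mul_assoc]
      exact (hg2 _).trans (mul_le_mul_of_nonneg_left ih hρ0)
  have hlim : Filter.Tendsto (fun n => ρ ^ n * ‖y‖) Filter.atTop (nhds 0) := by
    simpa using (tendsto_pow_atTop_nhds_zero_of_lt_one hρ0 hρ1).mul_const ‖y‖
  have hsum : Summable fun n => g (e n) := by
    refine NonarchimedeanAddGroup.summable_of_tendsto_cofinite_zero ?_
    rw [Nat.cofinite_eq_atTop]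
    exact squeeze_zero_norm (fun n => (hg1 _).trans (hle n)) hlim
  have hpart (n : ℕ) : L (∑ i ∈ Finset.range n, g (e i)) = y - e n := by
    induction n with
    | zero => simp [he0]
    | succ n ih =>
      rw [Finset.sum_range_succ, map_add, ih, he]
      abel
  have hcont : Continuous L :=
    (AddMonoidHomClass.lipschitz_of_bound L 1 fun x => by simpa using hL x).continuous
  refine ⟨∑' n, g (e n), ?_, ?_⟩
  · refine tendsto_nhds_unique ((hcont.tendsto _).comp hsum.hasSum.tendsto_sum_nat) ?_
    have h0 : Filter.Tendsto e Filter.atTop (nhds 0) := squeeze_zero_norm hle hlim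
    simpa [Function.comp_def, hpart] using h0.const_sub y
  · refine le_of_tendsto hsum.hasSum.tendsto_sum_nat.norm (Filter.Eventually.of_forall fun n => ?_)
    refine IsUltrametricDist.norm_sum_le_of_forall_le_of_nonneg (norm_nonneg y) fun i _ => ?_
    refine (hg1 _).trans ((hle i).trans ?_)
    exact mul_le_of_le_one_left (norm_nonneg _) (pow_le_one₀ hρ0 hρ1.le)

instance Prod.instIsUltrametricDist {X Y : Type*} [PseudoMetricSpace X] [PseudoMetricSpace Y]
    [IsUltrametricDist X] [IsUltrametricDist Y] : IsUltrametricDist (X × Y) where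
  dist_triangle_max x y z := by
    simp only [Prod.dist_eq]
    refine max_le ((dist_triangle_max x.1 y.1 z.1).trans ?_)
      ((dist_triangle_max x.2 y.2 z.2).trans ?_)
    · exact max_le_max (le_max_left _ _) (le_max_left _ _)
    · exact max_le_max (le_max_right _ _) (le_max_right _ _)

section Weierstrass

variable {K : Type} [NormedField K] [IsUltrametricDist K] [CompleteSpace K] [IsAlgClosed K]
variable {n : ℕ}

/-- Polynomials in the first variable over the strictly convergent power series in the others, as
strictly convergent power series. -/
def polyPull : Polynomial (TateAlgR K n) →ₐ[Ro K] TateAlgR K (n + 1) :=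
  { Polynomial.eval₂RingHom succPull.toRingHom (coordR 0) with
    commutes' := fun r => by
      change Polynomial.eval₂ _ _ _ = _
      rw [IsScalarTower.algebraMap_apply (Ro K) (TateAlgR K n) (Polynomial (TateAlgR K n)),
        Polynomial.algebraMap_eq, Polynomial.eval₂_C]
      exact succPull.commutes r }

@[simp] lemma polyPull_C (f : TateAlgR K n) : polyPull (Polynomial.C f) = succPull f :=
  Polynomial.eval₂_C _ _

@[simp] lemma polyPull_X : polyPull Polynomial.X = (coordR 0 : TateAlgR K (n + 1)) :=
  Polynomial.eval₂_X _ _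

lemma polyPull_map_polyFn (p : Polynomial (MvPolynomial (Fin n) (Ro K))) :
    polyPull (p.map polyFn.toRingHom) = polyFn ((MvPolynomial.finSuccEquiv (Ro K) n).symm p) := by
  obtain ⟨q, rfl⟩ := (MvPolynomial.finSuccEquiv (Ro K) n).surjective p
  rw [AlgEquiv.symm_apply_apply]
  have : (polyPull.comp (Polynomial.mapAlgHom polyFn)).comp
      (MvPolynomial.finSuccEquiv (Ro K) n).toAlgHom = polyFn := by
    ext1 i
    refine Fin.cases ?_ (fun j => ?_) i
    · simp [MvPolynomial.finSuccEquiv_X_zero]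
    · simp [MvPolynomial.finSuccEquiv_X_succ, succPull, pull_coordR]
  exact congrArg (fun φ => φ q) this

lemma polyPull_eq_sum {p : Polynomial (TateAlgR K n)} {e : ℕ} (hp : p.degree < e) :
    polyPull p = ∑ i : Fin e, succPull (p.coeff i) * coordR 0 ^ (i : ℕ) := by
  refine (Polynomial.eval₂_eq_sum).trans ?_
  exact (Polynomial.sum_fin (fun i a => succPull a * coordR 0 ^ i) (by simp) hp).symm

/-- Weierstrass division by a power series close to a monic polynomial. -/
theorem weierstrass_division {g : TateAlgR K (n + 1)}
    {w : Polynomial (MvPolynomial (Fin n) (Ro K))} (hw : w.Monic)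
    (hg : ‖g - polyPull (w.map polyFn.toRingHom)‖ < 1) (f : TateAlgR K (n + 1)) :
    ∃ (q : TateAlgR K (n + 1)) (r : Polynomial (TateAlgR K n)), r.degree < w.natDegree ∧
      f = q * g + polyPull r ∧ ‖q‖ ≤ ‖f‖ := by
  set W := polyPull (w.map polyFn.toRingHom) with hW
  let L : TateAlgR K (n + 1) × (Fin w.natDegree → TateAlgR K n) →+ TateAlgR K (n + 1) :=
    { toFun := fun x => x.1 * g + ∑ i, succPull (x.2 i) * coordR 0 ^ (i : ℕ)
      map_zero' := by simp
      map_add' := fun x y => by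
        simp only [Prod.fst_add, Prod.snd_add, Pi.add_apply, map_add, add_mul,
          Finset.sum_add_distrib]
        ring }
  have hmul (a b : TateAlgR K (n + 1)) : ‖a * b‖ ≤ ‖a‖ :=
    (norm_mul_le a b).trans (mul_le_of_le_one_right (norm_nonneg a) (TateAlgR.norm_le_one b))
  have hL (x) : ‖L x‖ ≤ ‖x‖ := by
    refine (IsUltrametricDist.norm_add_le_max _ _).trans (max_le ?_ ?_)
    · exact (hmul _ _).trans (norm_fst_le x)
    · refine IsUltrametricDist.norm_sum_le_of_forall_le_of_nonneg (norm_nonneg x) fun i _ => ?_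
      exact (hmul _ _).trans ((norm_succPull_le _).trans
        ((norm_le_pi_norm x.2 i).trans (norm_snd_le x)))
  have key : ∀ y, ∃ x, ‖x‖ ≤ ‖y‖ ∧ ‖y - L x‖ ≤ max ‖g - W‖ (1 / 2) * ‖y‖ := by
    intro y
    by_cases hy : y = 0
    · exact ⟨0, by simp [hy]⟩
    obtain ⟨c, y, -, hy1, rfl⟩ := exists_eq_algebraMap_mul hy
    obtain ⟨p, hp⟩ := exists_norm_sub_polyFn_lt y (ε := 1 / 2) (by norm_num)
    obtain ⟨p, rfl⟩ := (MvPolynomial.finSuccEquiv (Ro K) n).symm.surjective p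
    rw [← polyPull_map_polyFn] at hp
    set d := (p /ₘ w).map polyFn.toRingHom
    set r := (p %ₘ w).map polyFn.toRingHom with hr
    have hpd : p.map polyFn.toRingHom = r + w.map polyFn.toRingHom * d := by
      rw [← Polynomial.map_mul, ← Polynomial.map_add, Polynomial.modByMonic_add_div]
    have hrdeg : r.degree < w.natDegree := by
      refine (Polynomial.degree_map_le).trans_lt ?_
      rw [← Polynomial.degree_eq_natDegree hw.ne_zero]
      exact Polynomial.degree_modByMonic_lt _ hw
    rw [TateAlgR.norm_algebraMap_mul, hy1, mul_one]
    refine ⟨(algebraMap (Ro K) _ c * polyPull d,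
      fun i => algebraMap (Ro K) _ c * r.coeff i), ?_, ?_⟩
    · refine norm_prod_le_iff.2 ⟨?_, (pi_norm_le_iff_of_nonneg (norm_nonneg _)).2 fun i => ?_⟩ <;>
      · rw [TateAlgR.norm_algebraMap_mul]
        exact mul_le_of_le_one_right (norm_nonneg _) (TateAlgR.norm_le_one _)
    · have hLx : L (algebraMap (Ro K) _ c * polyPull d,
          fun i => algebraMap (Ro K) _ c * r.coeff i)
          = algebraMap (Ro K) _ c * (polyPull d * g + polyPull r) := by
        change _ * g + ∑ i, _ = _
        rw [polyPull_eq_sum hrdeg]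
        simp only [map_mul, AlgHom.commutes, mul_assoc, ← Finset.mul_sum, ← mul_add]
      have heq : algebraMap (Ro K) _ c * y - algebraMap (Ro K) _ c * (polyPull d * g + polyPull r)
          = algebraMap (Ro K) _ c * ((y - polyPull (p.map polyFn.toRingHom))
            - (g - W) * polyPull d) := by
        rw [hpd, map_add, map_mul]
        ring
      rw [hLx, heq, TateAlgR.norm_algebraMap_mul, mul_comm]
      refine mul_le_mul_of_nonneg_right ?_ (norm_nonneg _)
      rw [sub_eq_add_neg]
      refine (IsUltrametricDist.norm_add_le_max _ _).trans (max_le ?_ ?_)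
      · exact hp.le.trans (le_max_right _ _)
      · rw [norm_neg]
        exact (hmul _ _).trans (le_max_left _ _)
  obtain ⟨x, hx, hxn⟩ := exists_eq_of_forall_exists_norm_sub_le L hL
    (le_max_of_le_left (norm_nonneg _)) (max_lt hg (by norm_num)) key f
  have hdeg : (∑ i : Fin w.natDegree, Polynomial.C (x.2 i) * Polynomial.X ^ (i : ℕ)).degree
      < (w.natDegree : WithBot ℕ) := Polynomial.degree_sum_fin_lt _
  refine ⟨x.1, _, hdeg, ?_, (norm_fst_le x).trans hxn⟩
  rw [← hx, map_sum]
  simp only [map_mul, map_pow, polyPull_C, polyPull_X]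
  rfl

/-- Weierstrass preparation for a power series close to a monic polynomial. -/
theorem weierstrass_preparation {g : TateAlgR K (n + 1)}
    {w : Polynomial (MvPolynomial (Fin n) (Ro K))} (hw : w.Monic)
    (hg : ‖g - polyPull (w.map polyFn.toRingHom)‖ < 1) :
    ∃ (u : (TateAlgR K (n + 1))ˣ) (ω : Polynomial (TateAlgR K n)), ω.Monic ∧
      ω.natDegree = w.natDegree ∧ polyPull ω = u * g := by
  set W := w.map (polyFn (K := K)).toRingHom with hW
  obtain ⟨q, r, hr, h, hq⟩ := weierstrass_division hw hg (polyPull W - g)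
  rw [norm_sub_rev] at hq
  have hu : IsUnit (1 - -q) :=
    isUnit_one_sub_of_norm_lt_one (by rw [norm_neg]; exact hq.trans_lt hg)
  have hWm : W.Monic := hw.map _
  have hWd : W.natDegree = w.natDegree := hw.natDegree_map _
  have hdeg : r.degree < W.degree := by
    rwa [Polynomial.degree_eq_natDegree hWm.ne_zero, hWd]
  refine ⟨hu.unit, W - r, hWm.sub_of_left hdeg, ?_, ?_⟩
  · rw [← hWd]
    exact Polynomial.natDegree_eq_of_degree_eq (Polynomial.degree_sub_eq_left_of_degree_lt hdeg)
  · rw [map_sub polyPull W r, IsUnit.unit_spec]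
    linear_combination h

end Weierstrass
end RigidQE
end

noncomputable section
namespace RigidQE

section Shear

open MvPolynomial

/-- The images of the variables under the shear fixing `X₀` and adding `c • X₀ ^ N ^ i` to each
other variable `Xᵢ`. -/
def shearFn {k : Type*} [CommRing k] {n : ℕ} (N : ℕ) (c : k) (i : Fin (n + 1)) :
    MvPolynomial (Fin (n + 1)) k :=
  if i = 0 then X 0 else X i + c • X 0 ^ N ^ (i : ℕ)

lemma map_shearFn {k l : Type*} [CommRing k] [CommRing l] {n : ℕ} (φ : k →+* l) (N : ℕ) (c : k)
    (i : Fin (n + 1)) : map φ (shearFn N c i) = shearFn N (φ c) i := by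
  unfold shearFn
  split_ifs <;> simp [smul_eq_C_mul]

lemma map_aeval_shearFn {k l : Type*} [CommRing k] [CommRing l] {n : ℕ} (φ : k →+* l) (N : ℕ)
    (c : k) (p : MvPolynomial (Fin (n + 1)) k) :
    map φ (aeval (shearFn N c) p) = aeval (shearFn N (φ c)) (map φ p) := by
  induction p using MvPolynomial.induction_on with
  | C a => simp [algebraMap_eq]
  | add p q hp hq => simp only [map_add, hp, hq]
  | mul_X p i hp => simp only [map_mul, hp, aeval_X, map_X, map_shearFn]

variable {k : Type*} [Field k] {n : ℕ}

lemma sum_pow_mul_ne {N : ℕ} (hN : 1 < N) {v w : Fin (n + 1) →₀ ℕ} (hv : ∀ i, v i < N)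
    (hw : ∀ i, w i < N) (ne : v ≠ w) :
    ∑ x : Fin (n + 1), N ^ (x : ℕ) * v x ≠ ∑ x : Fin (n + 1), N ^ (x : ℕ) * w x := by
  intro h
  refine ne <| Finsupp.ext <| congrFun <| List.ofFn_inj.mp ?_
  apply Nat.ofDigits_inj_of_len_eq hN (by simp) (by grind) (by grind)
  simpa only [Nat.ofDigits_eq_sum_mapIdx, List.mapIdx_eq_ofFn, List.get_ofFn, List.length_ofFn,
    Fin.val_cast, mul_comm, List.sum_ofFn] using! h

lemma natDegree_finSuccEquiv_shear_monomial {N : ℕ} (hN : 0 < N) (v : Fin (n + 1) →₀ ℕ)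
    {a : k} (ha : a ≠ 0) :
    (finSuccEquiv k n (aeval (shearFn N 1) (monomial v a))).natDegree =
      ∑ i : Fin (n + 1), N ^ (i : ℕ) * v i := by
  rw [monomial_eq, Finsupp.prod_pow v fun a ↦ X a]
  simp only [Fin.prod_univ_succ, Fin.sum_univ_succ, map_mul, map_prod, map_pow, shearFn,
    MvPolynomial.aeval_C, MvPolynomial.aeval_X, if_pos, Fin.succ_ne_zero,
    ite_false, one_smul, map_add, finSuccEquiv_X_zero, finSuccEquiv_X_succ, algebraMap_eq]
  have h (i : Fin n) :
      (Polynomial.C (X (R := k) i) + Polynomial.X ^ N ^ (i.succ : ℕ)) ^ v i.succ ≠ 0 :=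
    pow_ne_zero (v i.succ) (Polynomial.leadingCoeff_ne_zero.mp <| by
      rw [add_comm, Polynomial.leadingCoeff_X_pow_add_C (pow_pos hN _)]
      exact one_ne_zero)
  rw [Polynomial.natDegree_mul (by simp [ha])
      (mul_ne_zero (by simp) (Finset.prod_ne_zero_iff.mpr (fun i _ ↦ h i))),
    Polynomial.natDegree_mul (by simp) (Finset.prod_ne_zero_iff.mpr (fun i _ ↦ h i)),
    Polynomial.natDegree_prod _ _ (fun i _ ↦ h i), natDegree_finSuccEquiv, degreeOf_C]
  simpa only [Polynomial.natDegree_pow, zero_add, Polynomial.natDegree_X, mul_one, Fin.val_zero,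
    pow_zero, one_mul, add_right_inj] using Finset.sum_congr rfl (fun i _ ↦ by
    rw [add_comm (Polynomial.C _), Polynomial.natDegree_X_pow_add_C, mul_comm])

lemma leadingCoeff_finSuccEquiv_shear_monomial {N : ℕ} (hN : 0 < N) (v : Fin (n + 1) →₀ ℕ)
    (a : k) :
    (finSuccEquiv k n (aeval (shearFn N 1) (monomial v a))).leadingCoeff = C a := by
  rw [monomial_eq, Finsupp.prod_fintype _ _ fun i ↦ pow_zero _]
  simp only [map_mul, map_prod, Polynomial.leadingCoeff_mul, Polynomial.leadingCoeff_prod, map_pow,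
    Polynomial.leadingCoeff_pow, aeval_C, aeval_X]
  have (j : Fin (n + 1)) : (finSuccEquiv k n (shearFn N 1 j)).leadingCoeff = 1 := by
    unfold shearFn
    by_cases h : j = 0
    · simp [h, finSuccEquiv_X_zero]
    · obtain ⟨i, rfl⟩ := Fin.exists_succ_eq.mpr h
      simp only [Fin.succ_ne_zero, ite_false, one_smul, map_add, map_pow, finSuccEquiv_X_succ,
        finSuccEquiv_X_zero, add_comm (Polynomial.C _)]
      exact Polynomial.leadingCoeff_X_pow_add_C (pow_pos hN _)
  rw [algebraMap_eq, MvPolynomial.finSuccEquiv_apply, eval₂Hom_C]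
  simp [this]

/-- After a suitable shear, the leading coefficient in the first variable of a nonzero polynomial
over a field is a nonzero constant. -/
lemma exists_leadingCoeff_finSuccEquiv_shear {f : MvPolynomial (Fin (n + 1)) k} (hf : f ≠ 0) :
    ∃ (N : ℕ) (a : k), a ≠ 0 ∧
      (finSuccEquiv k n (aeval (shearFn N 1) f)).leadingCoeff = C a := by
  set N := 2 + f.totalDegree with hN
  set T : MvPolynomial (Fin (n + 1)) k →ₐ[k] Polynomial (MvPolynomial (Fin n) k) :=
    (finSuccEquiv k n).toAlgHom.comp (aeval (shearFn N 1)) with hT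
  have hlt {v} (hv : v ∈ f.support) (i) : v i < N :=
    ((monomial_le_degreeOf i hv).trans (degreeOf_le_totalDegree f i)).trans_lt (by omega)
  set h := fun v => monomial v (coeff v f) with hh
  have hdeg {v} (hv : v ∈ f.support) : (T (h v)).natDegree =
      ∑ i : Fin (n + 1), N ^ (i : ℕ) * v i :=
    natDegree_finSuccEquiv_shear_monomial (by omega) v (mem_support_iff.1 hv)
  have hlead (v) : (T (h v)).leadingCoeff = C (coeff v f) :=
    leadingCoeff_finSuccEquiv_shear_monomial (by omega) v _
  obtain ⟨v, hv, hmax⟩ := Finset.exists_max_image f.support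
    (fun v => (T (h v)).natDegree) (support_nonempty.mpr hf)
  have hv0 : coeff v f ≠ 0 := mem_support_iff.1 hv
  refine ⟨N, coeff v f, hv0, ?_⟩
  change (T f).leadingCoeff = _
  have hsum : T f = ∑ x ∈ f.support \ {v}, T (h x) + T (h v) := by
    conv_lhs => rw [← f.support_sum_monomial_coeff]
    rw [map_sum, Finset.sum_eq_add_sum_sdiff_singleton_of_mem hv, add_comm]
  have hne : T (h v) ≠ 0 := fun h0 => by
    have := hlead v
    rw [h0, Polynomial.leadingCoeff_zero, eq_comm, C_eq_zero] at this
    exact hv0 this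
  rw [hsum, Polynomial.leadingCoeff_add_of_degree_lt, hlead]
  refine (Polynomial.degree_sum_le _ _).trans_lt
    ((Finset.sup_lt_iff (Ne.bot_lt fun x => hne (Polynomial.degree_eq_bot.1 x))).2 fun x hx => ?_)
  obtain ⟨hx1, hx2⟩ := Finset.mem_sdiff.1 hx
  refine Polynomial.degree_lt_degree ((hmax x hx1).lt_of_ne ?_)
  rw [hdeg hx1, hdeg hv]
  exact sum_pow_mul_ne (by omega) (hlt hx1) (hlt hv) (by simpa using hx2)

end Shear

section DistinguishedCoordinates

variable {K : Type} [NormedField K] [IsUltrametricDist K] [CompleteSpace K] [IsAlgClosed K]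
variable {n : ℕ}

/-- The shear of the unit polydisc, acting on strictly convergent power series. -/
def shear (N : ℕ) (c : Ro K) : TateAlgR K (n + 1) →ₐ[Ro K] TateAlgR K (n + 1) :=
  pull fun i => polyFn (shearFn N c i)

lemma shear_polyFn (N : ℕ) (c : Ro K) (p : MvPolynomial (Fin (n + 1)) (Ro K)) :
    shear N c (polyFn p) = polyFn (MvPolynomial.aeval (shearFn N c) p) := by
  rw [shear, pull_polyFn, ← AlgHom.comp_apply polyFn, MvPolynomial.comp_aeval]

lemma shear_shear_neg (N : ℕ) (c : Ro K) (f : TateAlgR K (n + 1)) :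
    shear N c (shear N (-c) f) = f := by
  refine TateAlgR.ext_evalPt fun z => ?_
  rw [shear, shear, evalPt_pull, evalPt_pull]
  conv_rhs => rw [← ofCoords_coords z]
  refine congrArg (fun c => evalPt (ofCoords c) f) (funext fun i => ?_)
  by_cases h : i = 0 <;> simp [evalPt_polyFn, shearFn, h, MvPolynomial.smul_eval]

lemma finSuccEquiv_map {A B : Type*} [CommRing A] [CommRing B] (φ : A →+* B)
    (p : MvPolynomial (Fin (n + 1)) A) : MvPolynomial.finSuccEquiv B n (MvPolynomial.map φ p) =
      (MvPolynomial.finSuccEquiv A n p).map (MvPolynomial.map φ) := by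
  ext i d
  simp [MvPolynomial.finSuccEquiv_coeff_coeff, MvPolynomial.coeff_map]

/-- Every power series of norm one becomes, after a shear and up to a unit, close to a polynomial
which is monic in the first variable. -/
lemma exists_shear_close_to_monic {g : TateAlgR K (n + 1)} (hg : ‖g‖ = 1) :
    ∃ (N : ℕ) (c : Ro K) (w : Polynomial (MvPolynomial (Fin n) (Ro K))), IsUnit c ∧ w.Monic ∧
      ‖algebraMap (Ro K) (TateAlgR K (n + 1)) c * shear N 1 g -
        polyPull (w.map polyFn.toRingHom)‖ < 1 := by
  obtain ⟨p, hp⟩ := exists_norm_sub_polyFn_lt g one_pos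
  have hp0 := redPoly_ne_zero_of_norm_sub_lt hg hp
  obtain ⟨N, a, ha, hlead⟩ := exists_leadingCoeff_finSuccEquiv_shear hp0
  obtain ⟨c, hc⟩ := Ideal.Quotient.mk_surjective a⁻¹
  have hcu : IsUnit c := isUnit_of_norm_eq_one <| notMem_RoMax.1 fun h => inv_ne_zero ha <| by
    rw [← hc, Ideal.Quotient.eq_zero_iff_mem.2 h]
  have hred : MvPolynomial.aeval (shearFn N 1) (redPoly p)
      = redPoly (MvPolynomial.aeval (shearFn N (1 : Ro K)) p) := by
    rw [redPoly, map_aeval_shearFn, map_one]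
  set P := MvPolynomial.aeval (shearFn N (1 : Ro K)) p with hP
  rw [hred, finSuccEquiv_map] at hlead
  have hmonic :
      ((MvPolynomial.finSuccEquiv (Ro K) n (MvPolynomial.C c * P)).map redPoly).Monic := by
    rw [Polynomial.Monic, ← finSuccEquiv_map, map_mul, map_mul, Polynomial.leadingCoeff_mul,
      finSuccEquiv_map _ P, hlead, MvPolynomial.map_C, hc, ← MvPolynomial.algebraMap_eq,
      AlgEquiv.commutes, IsScalarTower.algebraMap_apply (Res K) (MvPolynomial (Fin n) (Res K))
        (Polynomial (MvPolynomial (Fin n) (Res K))), Polynomial.algebraMap_eq,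
      Polynomial.leadingCoeff_C, MvPolynomial.algebraMap_eq, ← MvPolynomial.C_mul,
      inv_mul_cancel₀ ha, MvPolynomial.C_1]
  obtain ⟨w, hw, -, hwm⟩ := Polynomial.lifts_and_natDegree_eq_and_monic (f := redPoly)
    ((Polynomial.mem_lifts _).2 (Polynomial.map_surjective _
      (MvPolynomial.map_surjective _ Ideal.Quotient.mk_surjective) _)) hmonic
  refine ⟨N, c, w, hcu, hwm, ?_⟩
  have h1 : redPoly (MvPolynomial.C c * P - (MvPolynomial.finSuccEquiv (Ro K) n).symm w) = 0 := by
    rw [← map_eq_zero_iff _ (MvPolynomial.finSuccEquiv (Res K) n).injective, finSuccEquiv_map,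
      map_sub, AlgEquiv.apply_symm_apply, Polynomial.map_sub, hw, sub_self]
  have h2 : algebraMap (Ro K) _ c * shear N (1 : Ro K) g - polyPull (w.map polyFn.toRingHom)
      = algebraMap (Ro K) _ c * shear N 1 (g - polyFn p) +
        polyFn (MvPolynomial.C c * P - (MvPolynomial.finSuccEquiv (Ro K) n).symm w) := by
    rw [polyPull_map_polyFn, map_sub polyFn, map_sub (shear N (1 : Ro K)), map_mul, shear_polyFn,
      ← MvPolynomial.algebraMap_eq, AlgHom.commutes]
    ring
  rw [h2]
  refine (IsUltrametricDist.norm_add_le_max _ _).trans_lt (max_lt ?_ (norm_polyFn_lt_one h1))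
  rw [TateAlgR.norm_algebraMap_mul]
  refine (mul_le_of_le_one_left (norm_nonneg _) c.2).trans_lt ?_
  exact (norm_pull_le _ _).trans_lt hp

/-- Weierstrass division and preparation for a power series of norm one, after a shear. -/
theorem exists_shear_weierstrass {g : TateAlgR K (n + 1)} (hg : ‖g‖ = 1) :
    ∃ (N : ℕ) (u : (TateAlgR K (n + 1))ˣ) (ω : Polynomial (TateAlgR K n)), ω.Monic ∧
      polyPull ω = u * shear N (1 : Ro K) g ∧ ∀ f : TateAlgR K (n + 1),
        ∃ (q : TateAlgR K (n + 1)) (r : Polynomial (TateAlgR K n)), r.degree < ω.degree ∧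
          f = q * shear N (1 : Ro K) g + polyPull r := by
  obtain ⟨N, c, w, hc, hw, h⟩ := exists_shear_close_to_monic hg
  obtain ⟨u, ω, hω, hdeg, hu⟩ := weierstrass_preparation hw h
  refine ⟨N, u * (hc.map (algebraMap (Ro K) _)).unit, ω, hω, ?_, fun f => ?_⟩
  · rw [hu, Units.val_mul, IsUnit.unit_spec, mul_assoc]
  · obtain ⟨q, r, hr, hf, -⟩ := weierstrass_division hw h f
    refine ⟨q * algebraMap (Ro K) _ c, r, ?_, by rw [hf, mul_assoc]⟩
    rwa [Polynomial.degree_eq_natDegree hω.ne_zero, hdeg]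

end DistinguishedCoordinates
end RigidQE
end

noncomputable section
namespace RigidQE

section NoetherNormalization

variable {K : Type} [NormedField K] [IsUltrametricDist K] [CompleteSpace K] [IsAlgClosed K]

lemma isIntegral_of_forall_isIntegralElem {A C B : Type*} [CommRing A] [CommRing C] [CommRing B]
    (φ : A →+* B) (ψ : C →+* B) (hψ : ψ.IsIntegral) (h : ∀ y, φ.IsIntegralElem (ψ y)) :
    φ.IsIntegral := fun b => by
  algebraize [φ]
  obtain ⟨p, hp, hb⟩ := hψ b
  let ψ' : C →+* integralClosure A B := ψ.codRestrict _ h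
  refine isIntegral_trans (A := integralClosure A B) b ⟨p.map ψ', hp.map _, ?_⟩
  rw [Polynomial.eval₂_map]
  exact hb

lemma isIntegral_comp_succPull {n : ℕ} {B : Type*} [CommRing B] [Algebra (Ro K) B]
    (θ : TateAlgR K (n + 1) →ₐ[Ro K] B) (hθ : θ.toRingHom.IsIntegral)
    {g : TateAlgR K (n + 1)} (hg : θ g = 0) {ω : Polynomial (TateAlgR K n)} (hω : ω.Monic)
    (hω0 : θ (polyPull ω) = 0) (hdiv : ∀ f, ∃ (q : TateAlgR K (n + 1))
      (r : Polynomial (TateAlgR K n)), f = q * g + polyPull r) :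
    (θ.comp succPull).toRingHom.IsIntegral := by
  have heval (p : Polynomial (TateAlgR K n)) :
      θ (polyPull p) = p.eval₂ (θ.comp succPull).toRingHom (θ (coordR 0)) :=
    Polynomial.hom_eval₂ p succPull.toRingHom θ.toRingHom (coordR 0)
  refine isIntegral_of_forall_isIntegralElem _ θ.toRingHom hθ fun y => ?_
  obtain ⟨q, r, rfl⟩ := hdiv y
  change RingHom.IsIntegralElem _ (θ _)
  rw [map_add, map_mul, hg, mul_zero, zero_add, heval]
  have ht : (θ.comp succPull).toRingHom.IsIntegralElem (θ (coordR 0)) :=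
    ⟨ω, hω, (heval ω).symm.trans hω0⟩
  algebraize [(θ.comp succPull).toRingHom]
  rw [Polynomial.eval₂_eq_sum]
  exact IsIntegral.sum _ fun i _ => isIntegral_algebraMap.mul (IsIntegral.pow ht i)

/-- Noether normalization for integral extensions of quotients of `R⟨S₁,…,Sₘ⟩`. -/
theorem exists_injective_isIntegral {B : Type*} [CommRing B] [IsDomain B] [Algebra (Ro K) B]
    (hB : Function.Injective (algebraMap (Ro K) B)) (m : ℕ) (θ : TateAlgR K m →ₐ[Ro K] B)
    (hθ : θ.toRingHom.IsIntegral) :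
    ∃ (d : ℕ) (θ' : TateAlgR K d →ₐ[Ro K] B), Function.Injective θ' ∧ θ'.toRingHom.IsIntegral := by
  induction m with
  | zero =>
    refine ⟨0, θ, (injective_iff_map_eq_zero θ).2 fun f hf => ?_, hθ⟩
    rw [← algebraMap_evalPt_of_zero (ofCoords 0) f, AlgHom.commutes,
      map_eq_zero_iff _ hB] at hf
    rw [← algebraMap_evalPt_of_zero (ofCoords 0) f, hf, map_zero]
  | succ n ih =>
    by_cases hinj : Function.Injective θ
    · exact ⟨n + 1, θ, hinj, hθ⟩
    rw [injective_iff_map_eq_zero] at hinj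
    push Not at hinj
    obtain ⟨f, hf, hf0⟩ := hinj
    obtain ⟨c, g, hc, hg, rfl⟩ := exists_eq_algebraMap_mul hf0
    rw [map_mul, AlgHom.commutes, mul_eq_zero, map_eq_zero_iff _ hB, or_iff_right hc] at hf
    obtain ⟨N, u, ω, hω, hu, hdiv⟩ := exists_shear_weierstrass hg
    have hsh (x : TateAlgR K (n + 1)) : shear N (-1) (shear N 1 x) = x := by
      simpa using shear_shear_neg N (-1) x
    have hθ1 : (θ.comp (shear N (-1))) (shear N 1 g) = 0 := by
      rw [AlgHom.comp_apply, hsh, hf]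
    refine ih _ (isIntegral_comp_succPull (θ.comp (shear N (-1))) ?_ hθ1 hω ?_ fun x => ?_)
    · exact RingHom.IsIntegral.trans (shear N (-1)).toRingHom θ.toRingHom
        (RingHom.isIntegral_of_surjective _ fun x => ⟨_, hsh x⟩) hθ
    · rw [hu, map_mul, hθ1, mul_zero]
    · obtain ⟨q, r, -, h⟩ := hdiv x
      exact ⟨q, r, h⟩

end NoetherNormalization
end RigidQE
end

noncomputable section
namespace RigidQE

section DivisibilityByIntegrality

open Polynomial

/-- The homogenised form of the condition that the quotient `f / g` is integral. -/
def IsIntegralQuotient {D : Type*} [CommRing D] (f g : D) : Prop :=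
  ∃ p : D[X], p.Monic ∧ (p.scaleRoots g).eval f = 0

variable {D E : Type*} [CommRing D] [CommRing E]

lemma IsIntegralQuotient.map [Nontrivial E] {f g : D} (h : IsIntegralQuotient f g) (φ : D →+* E) :
    IsIntegralQuotient (φ f) (φ g) := by
  obtain ⟨p, hp, h0⟩ := h
  refine ⟨p.map φ, hp.map φ, ?_⟩
  rw [← map_scaleRoots _ _ _ (by simp [hp]), eval_map, eval₂_at_apply, h0, map_zero]

lemma IsIntegralQuotient.eq_zero [IsDomain D] {f : D} (h : IsIntegralQuotient f 0) : f = 0 := by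
  obtain ⟨p, hp, h0⟩ := h
  rw [scaleRoots_zero, hp.leadingCoeff] at h0
  simp only [one_smul, eval_pow, eval_X] at h0
  exact eq_zero_of_pow_eq_zero h0

lemma isIntegralQuotient_iff {F : Type*} [Field F] {j : D →+* F} (hj : Function.Injective j)
    {f g : D} (hg : g ≠ 0) : IsIntegralQuotient f g ↔ j.IsIntegralElem (j f / j g) := by
  have hg' : j g ≠ 0 := (map_ne_zero_iff j hj).2 hg
  refine exists_congr fun p => and_congr_right fun _ => ?_
  have := scaleRoots_eval₂_mul (p := p) j (j f / j g) g
  rw [mul_div_cancel₀ _ hg', eval₂_at_apply] at this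
  rw [← map_eq_zero_iff j hj, this, mul_eq_zero, or_iff_right (pow_ne_zero _ hg')]

variable [IsDomain D] {f g : D}

lemma isIntegralQuotient_iff_isIntegral (hg : g ≠ 0) : IsIntegralQuotient f g ↔
    IsIntegral D (algebraMap D (FractionRing D) f / algebraMap D (FractionRing D) g) :=
  isIntegralQuotient_iff (IsFractionRing.injective D (FractionRing D)) hg

lemma IsIntegralQuotient.of_mul_left {c : D} (hc : c ≠ 0) (hg : g ≠ 0)
    (h : IsIntegralQuotient (c * f) (c * g)) : IsIntegralQuotient f g := by
  rw [isIntegralQuotient_iff_isIntegral (mul_ne_zero hc hg), map_mul, map_mul,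
    mul_div_mul_left _ _ ((map_ne_zero_iff _ (IsFractionRing.injective D _)).2 hc)] at h
  exact (isIntegralQuotient_iff_isIntegral hg).2 h

lemma IsIntegralQuotient.mul_left (c : D) (hg : g ≠ 0)
    (h : IsIntegralQuotient f g) : IsIntegralQuotient (c * f) g := by
  rw [isIntegralQuotient_iff_isIntegral hg] at h ⊢
  rw [map_mul, mul_div_assoc]
  exact isIntegral_algebraMap.mul h

lemma IsIntegralQuotient.sub_mul (q : D) (hg : g ≠ 0)
    (h : IsIntegralQuotient f g) : IsIntegralQuotient (f - q * g) g := by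
  rw [isIntegralQuotient_iff_isIntegral hg] at h ⊢
  rw [map_sub, map_mul, sub_div,
    mul_div_cancel_right₀ _ ((map_ne_zero_iff _ (IsFractionRing.injective D _)).2 hg)]
  exact h.sub isIntegral_algebraMap

end DivisibilityByIntegrality

section Normality

open Polynomial

variable {K : Type} [NormedField K] [IsUltrametricDist K] [CompleteSpace K] [IsAlgClosed K]
variable {m n : ℕ}

/-- In one variable, a product of linear polynomials divides each polynomial which becomes integral
when divided by it. -/
lemma prod_dvd_of_isIntegralQuotient (s : Multiset (Ro K)) : ∀ r : (Ro K)[X],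
    IsIntegralQuotient (aeval (coordR 0 : TateAlgR K 1) r)
      (aeval (coordR 0 : TateAlgR K 1) (s.map fun a => X - C a).prod) →
    (s.map fun a => X - C a).prod ∣ r := by
  have hne (a : Ro K) : aeval (coordR 0 : TateAlgR K 1) (X - C a) ≠ 0 := fun h => by
    have := congrArg (evalPt (ofCoords fun _ => a + 1)) h
    simp [evalPt_polyFn] at this
  have hne' (s : Multiset (Ro K)) :
      aeval (coordR 0 : TateAlgR K 1) (s.map fun a => X - C a).prod ≠ 0 := by
    rw [map_multiset_prod, Multiset.map_map]
    refine Multiset.prod_ne_zero fun h => ?_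
    obtain ⟨a, -, ha⟩ := Multiset.mem_map.1 h
    exact hne a ha
  induction s using Multiset.induction_on with
  | empty => simp
  | cons a s ih =>
    intro r hr
    rw [Multiset.map_cons, Multiset.prod_cons, map_mul] at hr
    have h1 := hr.map (evalPt (ofCoords fun _ => a)).toRingHom
    have h2 : r.IsRoot a := by
      have h3 (q : (Ro K)[X]) :
          evalPt (ofCoords fun _ => a) (aeval (coordR 0 : TateAlgR K 1) q) = q.eval a := by
        rw [← aeval_algHom_apply, evalPt_coordR, coords_ofCoords, coe_aeval_eq_eval]
      change IsIntegralQuotient (evalPt _ _) (evalPt _ _) at h1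
      rw [map_mul, h3, h3, eval_sub, eval_X, eval_C, sub_self, zero_mul] at h1
      exact h1.eq_zero
    obtain ⟨q, rfl⟩ := dvd_iff_isRoot.2 h2
    rw [map_mul] at hr
    rw [Multiset.map_cons, Multiset.prod_cons]
    exact mul_dvd_mul_left _ (ih q (hr.of_mul_left (hne a) (hne' s)))

lemma restrictLine_polyPull (x : Fin n → Ro K) (p : (TateAlgR K n)[X]) :
    restrictLine x (polyPull p) =
      aeval (coordR 0 : TateAlgR K 1) (p.map (evalPt (ofCoords x)).toRingHom) := by
  refine (hom_eval₂ p succPull.toRingHom (restrictLine x).toRingHom (coordR 0)).trans ?_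
  rw [aeval_def, eval₂_map]
  congr 1
  · exact RingHom.ext fun f => restrictLine_succPull x f
  · exact restrictLine_coordR_zero x

lemma polyPull_eq_zero_of_isIntegralQuotient {ω r : (TateAlgR K n)[X]} (hω : ω.Monic)
    (hr : r.degree < ω.degree) (h : IsIntegralQuotient (polyPull r) (polyPull ω)) :
    polyPull r = 0 := by
  refine eq_of_restrictLine_eq fun x => ?_
  have h1 := h.map (restrictLine x).toRingHom
  change IsIntegralQuotient (restrictLine x _) (restrictLine x _) at h1
  rw [restrictLine_polyPull, restrictLine_polyPull] at h1
  set φ := (evalPt (ofCoords x)).toRingHom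
  have hdeg : (r.map φ).degree < (ω.map φ).degree := by
    rw [hω.degree_map]
    exact degree_map_le.trans_lt hr
  obtain ⟨s, hs⟩ := splits_of_monic _ (ω.map φ) (hω.map φ) rfl
  rw [hs] at h1
  have h2 := prod_dvd_of_isIntegralQuotient s _ h1
  rw [← hs] at h2
  rw [restrictLine_polyPull, eq_zero_of_dvd_of_degree_lt h2 hdeg, map_zero, map_zero]

lemma dvd_of_isIntegralQuotient_of_norm_eq_one {f g : TateAlgR K m} (hg : ‖g‖ = 1)
    (h : IsIntegralQuotient f g) : g ∣ f := by
  cases m with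
  | zero =>
    have hu : IsUnit (evalPt (ofCoords 0) g) := by
      refine isUnit_of_norm_eq_one (le_antisymm (evalPt (ofCoords 0) g).2 ?_)
      rw [← hg]
      refine (TateAlgR.norm_le_iff (norm_nonneg _)).2 fun w => ?_
      rw [Subsingleton.elim w (ofCoords 0)]
    rw [← algebraMap_evalPt_of_zero (ofCoords 0) g]
    exact (hu.map (algebraMap (Ro K) _)).dvd
  | succ n =>
    obtain ⟨N, u, ω, hω, hu, hdiv⟩ := exists_shear_weierstrass hg
    have hsh (x : TateAlgR K (n + 1)) : shear N (-1) (shear N 1 x) = x := by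
      simpa using shear_shear_neg N (-1) x
    have hg0 : shear N 1 g ≠ 0 := fun h0 => by
      have := hsh g
      rw [h0, map_zero] at this
      simp [← this] at hg
    obtain ⟨q, r, hr, hf⟩ := hdiv (shear N 1 f)
    have h1 : IsIntegralQuotient (shear N 1 f) (shear N 1 g) := h.map (shear N (1 : Ro K)).toRingHom
    have h2 := h1.sub_mul q hg0
    rw [hf, add_sub_cancel_left] at h2
    have h3 : IsIntegralQuotient (polyPull r) (polyPull ω) := by
      refine IsIntegralQuotient.of_mul_left
        (c := ((u⁻¹ : (TateAlgR K (n + 1))ˣ) : TateAlgR K (n + 1)))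
        u⁻¹.ne_zero ?_ ?_
      · rw [hu]
        exact mul_ne_zero u.ne_zero hg0
      · rw [hu, Units.inv_mul_cancel_left]
        exact h2.mul_left _ hg0
    rw [polyPull_eq_zero_of_isIntegralQuotient hω hr h3, add_zero] at hf
    refine ⟨shear N (-1) q, ?_⟩
    have := congrArg (shear N (-1)) hf
    rw [map_mul, hsh, hsh] at this
    rw [this, mul_comm]

lemma algebraMap_dvd_of_isIntegralQuotient {h : TateAlgR K m} {c : Ro K} (hc : c ≠ 0)
    (hint : IsIntegralQuotient h (algebraMap (Ro K) _ c)) :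
    algebraMap (Ro K) (TateAlgR K m) c ∣ h := by
  have hc' : (c : K) ≠ 0 := fun h => hc (Subtype.val_injective h)
  have hle : ‖h‖ ≤ ‖(c : K)‖ := by
    refine (TateAlgR.norm_le_iff (norm_nonneg _)).2 fun z => ?_
    have h1 := hint.map (evalPt z).toRingHom
    change IsIntegralQuotient (evalPt z _) (evalPt z _) at h1
    rw [AlgHom.commutes] at h1
    obtain ⟨p, hp, h2⟩ :=
      (isIntegralQuotient_iff (j := (Ro K).subtype) Subtype.val_injective hc).1 h1
    have h3 := norm_le_one_of_monic_of_eval₂_eq_zero hp h2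
    rw [norm_div] at h3
    exact (div_le_one (norm_pos_iff.2 hc')).1 h3
  by_cases h0 : h = 0
  · exact h0 ▸ dvd_zero _
  obtain ⟨d, g, hd, hg, rfl⟩ := exists_eq_algebraMap_mul h0
  rw [TateAlgR.norm_algebraMap_mul, hg, mul_one] at hle
  have : c ∣ d := by
    refine ⟨⟨(d : K) / c, ?_⟩, Subtype.val_injective (mul_div_cancel₀ _ hc').symm⟩
    change ‖(d : K) / c‖ ≤ 1
    rw [norm_div]
    exact (div_le_one (norm_pos_iff.2 hc')).2 hle
  exact (_root_.map_dvd (algebraMap (Ro K) _) this).mul_right g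

/-- The ring `R⟨S₁,…,Sₘ⟩` is integrally closed. -/
instance TateAlgR.isIntegrallyClosed : IsIntegrallyClosed (TateAlgR K m) := by
  refine (isIntegrallyClosed_iff (FractionRing (TateAlgR K m))).2 fun {x} hx => ?_
  obtain ⟨f, g, hg, rfl⟩ := IsFractionRing.div_surjective (A := TateAlgR K m) x
  have hg0 : g ≠ 0 := nonZeroDivisors.ne_zero hg
  obtain ⟨c, g, hc, hg1, rfl⟩ := exists_eq_algebraMap_mul hg0
  have hint := (isIntegralQuotient_iff_isIntegral hg0).2 hx
  have hc0 := left_ne_zero_of_mul hg0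
  have hg0' := right_ne_zero_of_mul hg0
  obtain ⟨h, rfl⟩ := dvd_of_isIntegralQuotient_of_norm_eq_one hg1
    ((hint.mul_left (algebraMap (Ro K) _ c) hg0).of_mul_left hc0 hg0')
  rw [mul_comm _ g] at hint
  obtain ⟨k, rfl⟩ := algebraMap_dvd_of_isIntegralQuotient hc (hint.of_mul_left hg0' hc0)
  refine ⟨k, ?_⟩
  rw [eq_div_iff ((map_ne_zero_iff _ (IsFractionRing.injective _ _)).2 hg0), ← map_mul]
  congr 1
  ring

end Normality
end RigidQE
end

noncomputable section
namespace RigidQE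

section MaximalIdeals

variable {K : Type} [NormedField K] [IsUltrametricDist K] [CompleteSpace K] [IsAlgClosed K]
variable {m : ℕ}

lemma mem_of_isMaximal_of_norm_lt_one {M : Ideal (TateAlgR K m)} (hM : M.IsMaximal)
    {f : TateAlgR K m} (hf : ‖f‖ < 1) : f ∈ M := by
  by_contra hfM
  obtain ⟨g, hg⟩ := hM.exists_inv hfM
  obtain ⟨i, hi, h⟩ := hg
  refine hM.ne_top (M.eq_top_of_isUnit_mem hi ?_)
  have hlt : ‖g * f‖ < 1 := (norm_mul_le g f).trans_lt
    (mul_lt_one_of_nonneg_of_lt_one_right (TateAlgR.norm_le_one g) (norm_nonneg f) hf)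
  rw [← sub_eq_of_eq_add' h.symm]
  exact isUnit_one_sub_of_norm_lt_one hlt

lemma TateAlgR.algebraMap_mem_of_isMaximal {M : Ideal (TateAlgR K m)} (hM : M.IsMaximal)
    {r : Ro K} (hr : r ∈ RoMax K) : algebraMap (Ro K) (TateAlgR K m) r ∈ M := by
  refine mem_of_isMaximal_of_norm_lt_one hM ?_
  simpa using (TateAlgR.norm_algebraMap_mul r (1 : TateAlgR K m)).trans_lt
    (mul_lt_one_of_nonneg_of_lt_one_left (norm_nonneg _) (mem_RoMax.1 hr)
      (TateAlgR.norm_le_one _))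

lemma algebraMap_surjective_of_finiteType {F : Type*} [Field F] [Algebra (Ro K) F]
    [Algebra.FiniteType (Ro K) F] (h : ∀ r ∈ RoMax K, algebraMap (Ro K) F r = 0) :
    Function.Surjective (algebraMap (Ro K) F) := by
  let _ : Algebra (Res K) F := (Ideal.Quotient.lift (RoMax K) (algebraMap (Ro K) F) h).toAlgebra
  have : IsScalarTower (Ro K) (Res K) F := IsScalarTower.of_algebraMap_eq' rfl
  have : Algebra.FiniteType (Res K) F :=
    Algebra.FiniteType.of_restrictScalars_finiteType (Ro K) (Res K) F
  have : Module.Finite (Res K) F := finite_of_finite_type_of_isJacobsonRing _ _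
  have hs : Function.Surjective (algebraMap (Res K) F) :=
    (IsAlgClosed.algebraMap_bijective_of_isIntegral (k := Res K) (K := F)).2
  exact hs.comp Ideal.Quotient.mk_surjective

/-- Every maximal ideal of `R⟨S₁,…,Sₘ⟩` contains the ideal of a point of the polydisc. -/
lemma exists_ker_evalPt_le (M : Ideal (TateAlgR K m)) [hM : M.IsMaximal] :
    ∃ z : UnitBall K m, RingHom.ker (evalPt z) ≤ M := by
  let _ : Field (TateAlgR K m ⧸ M) := Ideal.Quotient.field M
  have hR (r : Ro K) (hr : r ∈ RoMax K) : algebraMap (Ro K) (TateAlgR K m) r ∈ M :=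
    TateAlgR.algebraMap_mem_of_isMaximal hM hr
  let π : MvPolynomial (Fin m) (Ro K) →ₐ[Ro K] TateAlgR K m ⧸ M :=
    (Ideal.Quotient.mkₐ (Ro K) M).comp polyFn
  have hmk (f : TateAlgR K m) : ∃ p, f - polyFn p ∈ M := by
    obtain ⟨p, hp⟩ := exists_norm_sub_polyFn_lt f one_pos
    exact ⟨p, mem_of_isMaximal_of_norm_lt_one hM hp⟩
  have hπ : Function.Surjective π := fun x => by
    obtain ⟨f, rfl⟩ := Ideal.Quotient.mk_surjective x
    obtain ⟨p, hp⟩ := hmk f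
    exact ⟨p, (Ideal.Quotient.eq.2 hp).symm⟩
  have : Algebra.FiniteType (Ro K) (TateAlgR K m ⧸ M) := Algebra.FiniteType.of_surjective π hπ
  have hs := algebraMap_surjective_of_finiteType (K := K) (F := TateAlgR K m ⧸ M)
    fun r hr => Ideal.Quotient.eq_zero_iff_mem.2 (hR r hr)
  choose c hc using fun i => hs (π (MvPolynomial.X i))
  refine ⟨ofCoords c, fun f hf => ?_⟩
  obtain ⟨p, hp⟩ := exists_norm_sub_polyFn_lt f one_pos
  have h1 : MvPolynomial.eval c p ∈ RoMax K := by
    have := (TateAlgR.norm_evalPt_le (f - polyFn p) (ofCoords c)).trans_lt hp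
    rw [map_sub, RingHom.mem_ker.1 hf, zero_sub, evalPt_polyFn, coords_ofCoords] at this
    rw [← neg_mem_iff]
    exact this
  have h2 : π p = algebraMap (Ro K) _ (MvPolynomial.eval c p) := by
    have : π = (Algebra.ofId (Ro K) _).comp (MvPolynomial.aeval c) := by
      ext i
      simpa [Algebra.ofId_apply] using (hc i).symm
    rw [this]
    rfl
  have h3 : polyFn p ∈ M := by
    refine Ideal.Quotient.eq_zero_iff_mem.1 (h2.trans ?_)
    exact Ideal.Quotient.eq_zero_iff_mem.2 (hR _ h1)
  exact (Submodule.sub_mem_iff_left M h3).1 (mem_of_isMaximal_of_norm_lt_one hM hp)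

end MaximalIdeals

section Sections

variable {K : Type} [NormedField K] [IsUltrametricDist K] [CompleteSpace K] [IsAlgClosed K]

lemma algebraMap_surjective_of_isIntegral {D : Type*} [CommRing D] [IsDomain D] [Algebra (Ro K) D]
    (h : (algebraMap (Ro K) D).IsIntegral) : Function.Surjective (algebraMap (Ro K) D) := by
  intro x
  obtain ⟨p, hp, hx⟩ := h x
  obtain ⟨s, rfl⟩ := splits_of_monic _ p hp rfl
  rw [← Polynomial.coe_eval₂RingHom, map_multiset_prod, Multiset.prod_eq_zero_iff,
    Multiset.map_map, Multiset.mem_map] at hx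
  obtain ⟨a, -, ha⟩ := hx
  refine ⟨a, ?_⟩
  have : x - algebraMap (Ro K) D a = 0 := by simpa using ha
  exact (sub_eq_zero.1 this).symm

/-- A prime `P` of an `R`-algebra with `R → B ⧸ P` bijective is the kernel of an `R`-point. -/
lemma exists_algHom_of_bijective {B : Type*} [CommRing B] [Algebra (Ro K) B] (P : Ideal B)
    (h : Function.Bijective (algebraMap (Ro K) (B ⧸ P))) :
    ∃ ψ : B →ₐ[Ro K] Ro K, RingHom.ker ψ = P := by
  let e : Ro K ≃ₐ[Ro K] B ⧸ P := AlgEquiv.ofBijective (Algebra.ofId _ _) h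
  refine ⟨(e.symm : (B ⧸ P) →ₐ[Ro K] Ro K).comp (Ideal.Quotient.mkₐ _ P), ?_⟩
  ext x
  rw [RingHom.mem_ker, AlgHom.comp_apply]
  change e.symm _ = 0 ↔ _
  rw [map_eq_zero_iff _ e.symm.injective]
  exact Ideal.Quotient.eq_zero_iff_mem

/-- Going down along a Noether normalization: below each maximal ideal of `B` there is the kernel
of an `R`-point. -/
lemma exists_algHom_ker_le {B : Type*} [CommRing B] [IsDomain B] [Algebra (Ro K) B] {d : ℕ}
    (θ : TateAlgR K d →ₐ[Ro K] B) (hinj : Function.Injective θ) (hint : θ.toRingHom.IsIntegral)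
    (M : Ideal B) [hM : M.IsMaximal] :
    ∃ ψ : B →ₐ[Ro K] Ro K, RingHom.ker ψ ≤ M := by
  let _ : Algebra (TateAlgR K d) B := θ.toRingHom.toAlgebra
  have : Algebra.IsIntegral (TateAlgR K d) B := ⟨hint⟩
  have : FaithfulSMul (TateAlgR K d) B := (faithfulSMul_iff_algebraMap_injective _ _).2 hinj
  have : (M.under (TateAlgR K d)).IsMaximal :=
    Ideal.isMaximal_comap_of_isIntegral_of_isMaximal M
  obtain ⟨z, hz⟩ := exists_ker_evalPt_le (M.under (TateAlgR K d))
  have : (RingHom.ker (evalPt z)).IsPrime := RingHom.ker_isPrime _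
  obtain ⟨P, hPM, hP, hover⟩ := Ideal.exists_ideal_le_liesOver_of_le M hz
  have hmem (f : TateAlgR K d) : θ f ∈ P ↔ evalPt z f = 0 := by
    rw [← RingHom.mem_ker, hover.over]
    rfl
  have hcongr (f : TateAlgR K d) : Ideal.Quotient.mk P (θ f) =
      algebraMap (Ro K) (B ⧸ P) (evalPt z f) := by
    refine Ideal.Quotient.eq.2 ?_
    rw [← θ.commutes, ← map_sub, hmem, map_sub, AlgHom.commutes]
    exact sub_self _
  suffices h : Function.Bijective (algebraMap (Ro K) (B ⧸ P)) by
    obtain ⟨ψ, rfl⟩ := exists_algHom_of_bijective P h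
    exact ⟨ψ, hPM⟩
  refine ⟨?_, algebraMap_surjective_of_isIntegral ?_⟩
  · refine (injective_iff_map_eq_zero _).2 fun r hr => ?_
    have : θ (algebraMap (Ro K) _ r) ∈ P := by
      rw [AlgHom.commutes]
      exact Ideal.Quotient.eq_zero_iff_mem.1 hr
    rw [hmem, AlgHom.commutes] at this
    exact this
  · intro x
    obtain ⟨b, rfl⟩ := Ideal.Quotient.mk_surjective x
    obtain ⟨p, hp, hb⟩ := hint b
    refine ⟨p.map (evalPt z).toRingHom, hp.map _, ?_⟩
    rw [Polynomial.eval₂_map]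
    have : (algebraMap (Ro K) (B ⧸ P)).comp (evalPt z).toRingHom =
        (Ideal.Quotient.mk P).comp θ.toRingHom := RingHom.ext fun f => (hcongr f).symm
    rw [this, ← Polynomial.hom_eval₂, hb, map_zero]

lemma exists_algHom_ker_le_of_isTopFinType {A0 : Type} [CommRing A0] [Algebra (Ro K) A0]
    (hA : IsTopFinType K A0) (hflat : Module.Flat (Ro K) A0) (I : Ideal A0) [hI : I.IsMaximal] :
    ∃ ψ : A0 →ₐ[Ro K] Ro K, RingHom.ker ψ ≤ I := by
  obtain ⟨m, φ, hφ⟩ := hA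
  obtain ⟨q, hq, hqI⟩ := Ideal.exists_minimalPrimes_le (bot_le : ⊥ ≤ I)
  have : q.IsPrime := hq.1.1
  have hB : Function.Injective (algebraMap (Ro K) (A0 ⧸ q)) := by
    refine (injective_iff_map_eq_zero _).2 fun r hr => ?_
    by_contra hr0
    have hrq : algebraMap (Ro K) A0 r ∈ q := Ideal.Quotient.eq_zero_iff_mem.1 hr
    have hreg : algebraMap (Ro K) A0 r ∈ nonZeroDivisors A0 := by
      refine mem_nonZeroDivisors_iff_right.2 fun x hx => ?_
      refine (Module.Flat.isSMulRegular_of_nonZeroDivisors (M := A0)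
        (mem_nonZeroDivisors_of_ne_zero hr0)).right_eq_zero_of_smul ?_
      rw [Algebra.smul_def, mul_comm, hx]
    exact Set.disjoint_left.1 (Ideal.disjoint_nonZeroDivisors_of_mem_minimalPrimes hq) hrq hreg
  obtain ⟨d, θ, hinj, hint⟩ := exists_injective_isIntegral hB m
    ((Ideal.Quotient.mkₐ (Ro K) q).comp φ)
    (RingHom.isIntegral_of_surjective _ (Ideal.Quotient.mk_surjective.comp hφ))
  have hle : RingHom.ker (Ideal.Quotient.mk q) ≤ I := by rwa [Ideal.mk_ker]
  have : (I.map (Ideal.Quotient.mk q)).IsMaximal :=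
    Ideal.IsMaximal.map_of_surjective_of_ker_le Ideal.Quotient.mk_surjective hle
  obtain ⟨ψ, hψ⟩ := exists_algHom_ker_le θ hinj hint (I.map (Ideal.Quotient.mk q))
  refine ⟨ψ.comp (Ideal.Quotient.mkₐ (Ro K) q), fun x hx => ?_⟩
  have h : Ideal.Quotient.mk q x ∈ I.map (Ideal.Quotient.mk q) := hψ hx
  rwa [← Ideal.mem_comap, Ideal.comap_map_of_surjective' _ Ideal.Quotient.mk_surjective,
    sup_eq_left.2 hle] at h

lemma algebraMap_mem_of_isMaximal {A0 : Type} [CommRing A0] [Algebra (Ro K) A0]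
    (hA : IsTopFinType K A0) {I : Ideal A0} (hI : I.IsMaximal) {r : Ro K} (hr : r ∈ RoMax K) :
    algebraMap (Ro K) A0 r ∈ I := by
  obtain ⟨m, φ, hφ⟩ := hA
  have : (I.comap φ).IsMaximal := Ideal.comap_isMaximal_of_surjective φ hφ
  have h : algebraMap (Ro K) (TateAlgR K m) r ∈ I.comap φ :=
    TateAlgR.algebraMap_mem_of_isMaximal ‹_› hr
  rwa [Ideal.mem_comap, AlgHom.commutes] at h

end Sections
end RigidQE
end

noncomputable section
namespace RigidQE

/-- Let `A°` be an `R`-flat `R`-algebra topologically of finite type and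
`A = A° ⊗_R K` the corresponding affinoid algebra.  Then the reduction map
`ξ : Sp A → Max A°` is surjective. -/
theorem reduction_map_surjective
    (K : Type) [NormedField K] [CompleteSpace K] [IsAlgClosed K] [IsUltrametricDist K]
    (A0 : Type) [CommRing A0] [Algebra (Ro K) A0]
    (hA : IsTopFinType K A0) (hflat : Module.Flat (Ro K) A0)
    (I : Ideal A0) (hI : I.IsMaximal) :
    ∃ y : SpPts K A0, redIdeal K A0 y = I := by
  obtain ⟨ψ, hψ⟩ := exists_algHom_ker_le_of_isTopFinType hA hflat I
  have hwp : ∀ {r : Ro K}, r ∈ RoMax K → algebraMap (Ro K) A0 r ∈ I :=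
    algebraMap_mem_of_isMaximal hA hI
  let y : SpPts K A0 := Algebra.TensorProduct.lift (Algebra.ofId K K)
    ((Algebra.ofId (Ro K) K).comp ψ) fun _ _ => Commute.all _ _
  have hy (x : A0) : x ∈ (RingHom.ker y.toRingHom).comap
      (Algebra.TensorProduct.includeRight (R := Ro K) (A := K) (B := A0)).toRingHom ↔
      ψ x = 0 := by
    rw [Ideal.mem_comap, RingHom.mem_ker]
    change y (1 ⊗ₜ x) = 0 ↔ _
    rw [Algebra.TensorProduct.lift_tmul, map_one, one_mul]
    exact Subtype.val_injective.eq_iff' rfl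
  refine ⟨y, le_antisymm (sup_le (fun x hx => hψ ((hy x).1 hx)) (Ideal.map_le_iff_le_comap.2
    fun r hr => hwp hr)) fun x hx => ?_⟩
  have hker : ψ (x - algebraMap (Ro K) A0 (ψ x)) = 0 := by
    rw [map_sub, AlgHom.commutes]
    exact sub_self _
  have hmem : algebraMap (Ro K) A0 (ψ x) ∈ I :=
    (Submodule.sub_mem_iff_right I hx).1 (hψ hker)
  have hr : ψ x ∈ RoMax K := by
    by_contra hr
    exact hI.ne_top (I.eq_top_of_isUnit_mem hmem
      ((isUnit_of_norm_eq_one (notMem_RoMax.1 hr)).map (algebraMap (Ro K) A0)))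
  rw [← sub_add_cancel x (algebraMap (Ro K) A0 (ψ x))]
  exact add_mem (Ideal.mem_sup_left ((hy _).2 hker))
    (Ideal.mem_sup_right (Ideal.mem_map_of_mem _ hr))

end RigidQE
end
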